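/- Fix integers d ≥ 3 and L ≥ 3 and let κ_RF^L := κ₁ ∘ ⋯ ∘ κ₁ ((L−1)-fold composition) be the random-feature kernel function of an L-layer ReLU network. Then there exist nonzero real constants C_even(d,L) and C_odd(d,L) such that μ_k(κ_RF^L) ∼ C_even(d,L) · k^{−d−2} as k → ∞ along even k and μ_k(κ_RF^L) ∼ C_odd(d,L) · k^{−d−2} as k → ∞ along odd k. -/

import Mathlib

open Filter Asymptotics Real Set Topology

/-- Legendre polynomial of degree `k` in dimension `d` (Rodrigues formula). -/
noncomputable def legendreP (d k : ℕ) (t : ℝ) : ℝ :=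
  (-1 / 2 : ℝ) ^ k * (Real.Gamma (((d : ℝ) - 1) / 2) / Real.Gamma ((k : ℝ) + ((d : ℝ) - 1) / 2)) *
    (1 - t ^ 2) ^ ((3 - (d : ℝ)) / 2) *
    iteratedDeriv k (fun s : ℝ => (1 - s ^ 2) ^ ((k : ℝ) + ((d : ℝ) - 3) / 2)) t

/-- Surface area `ω_{p-1}` of the unit sphere in `ℝ^p`. -/
noncomputable def sphereSurface (p : ℕ) : ℝ :=
  2 * Real.pi ^ ((p : ℝ) / 2) / Real.Gamma ((p : ℝ) / 2)

/-- `μ_k(κ)`, the `k`-th Legendre coefficient of `κ` in dimension `d`. -/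
noncomputable def legendreCoeff (d k : ℕ) (κ : ℝ → ℝ) : ℝ :=
  (sphereSurface (d - 1) / sphereSurface d) *
    ∫ t in (-1 : ℝ)..1, κ t * legendreP d k t * (1 - t ^ 2) ^ (((d : ℝ) - 3) / 2)

/-- The degree-0 arc-cosine function `κ₀(u) = 1 - arccos(u)/π`. -/
noncomputable def kappa0 (u : ℝ) : ℝ := 1 - Real.arccos u / Real.pi

/-- The degree-1 arc-cosine function `κ₁(u) = (√(1-u²) + u(π - arccos u))/π`. -/
noncomputable def kappa1 (u : ℝ) : ℝ :=
  (Real.sqrt (1 - u ^ 2) + u * (Real.pi - Real.arccos u)) / Real.pi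



/-- Un-normalised Gegenbauer polynomial coming out of the Rodrigues formula. -/
noncomputable def jp : ℕ → ℝ → Polynomial ℝ
  | 0, _ => 1
  | k + 1, l => (1 - Polynomial.X ^ 2) * Polynomial.derivative (jp k (l + 1)) -
      Polynomial.C (2 * (l + 1)) * Polynomial.X * jp k (l + 1)

/-- The eigenvalue. -/
noncomputable def eigN (k : ℕ) (l : ℝ) : ℝ := k * (k + 2 * l + 1)

lemma jp_ode (k : ℕ) : ∀ l : ℝ,
    (1 - Polynomial.X ^ 2) * Polynomial.derivative (Polynomial.derivative (jp k l)) -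
      Polynomial.C (2 * (l + 1)) * Polynomial.X * Polynomial.derivative (jp k l) +
      Polynomial.C (eigN k l) * jp k l = 0 := by
  induction k with
  | zero => intro l; simp [jp, eigN]
  | succ k ih =>
    intro l
    have h := ih (l + 1)
    have hd : Polynomial.derivative (jp (k + 1) l) =
        - Polynomial.C (eigN (k + 1) l) * jp k (l + 1) := by
      have : Polynomial.derivative (jp (k + 1) l) = ((1 - Polynomial.X ^ 2) *
        Polynomial.derivative (Polynomial.derivative (jp k (l + 1))) -
        Polynomial.C (2 * (l + 1 + 1)) * Polynomial.X * Polynomial.derivative (jp k (l + 1)) +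
        Polynomial.C (eigN k (l + 1)) * jp k (l + 1)) -
        Polynomial.C (eigN (k + 1) l) * jp k (l + 1) := by
        simp only [jp, eigN, Polynomial.derivative_sub, Polynomial.derivative_mul,
          Polynomial.derivative_C, Polynomial.derivative_X, Polynomial.derivative_pow,
          Polynomial.derivative_one, map_mul, map_add, map_one, map_natCast, map_ofNat]
        push_cast
        simp only [Polynomial.derivative_ofNat]
        ring
      rw [this, h]; ring
    rw [hd]
    simp only [Polynomial.derivative_mul, Polynomial.derivative_neg, Polynomial.derivative_C]
    rw [show jp (k + 1) l = (1 - Polynomial.X ^ 2) * Polynomial.derivative (jp k (l + 1)) -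
      Polynomial.C (2 * (l + 1)) * Polynomial.X * jp k (l + 1) from rfl]
    ring

lemma jp_eval_neg (k : ℕ) : ∀ (l t : ℝ), (jp k l).eval (-t) = (-1) ^ k * (jp k l).eval t := by
  suffices h : ∀ l : ℝ, (jp k l).comp (-Polynomial.X) = Polynomial.C ((-1) ^ k) * jp k l by
    intro l t
    have := congrArg (Polynomial.eval t) (h l)
    simpa using this
  induction k with
  | zero => intro l; simp [jp]
  | succ k ih =>
    intro l
    have h := ih (l + 1)
    have h2 := congrArg Polynomial.derivative h
    rw [Polynomial.derivative_comp] at h2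
    simp only [Polynomial.derivative_neg, Polynomial.derivative_X, Polynomial.derivative_mul,
      Polynomial.derivative_C] at h2
    have h3 : (Polynomial.derivative (jp k (l + 1))).comp (-Polynomial.X) =
      - Polynomial.C ((-1) ^ k) * Polynomial.derivative (jp k (l + 1)) := by
      linear_combination -h2
    simp only [jp, Polynomial.sub_comp, Polynomial.mul_comp, h, h3, Polynomial.one_comp,
      Polynomial.X_comp, Polynomial.pow_comp, Polynomial.C_comp, pow_succ, map_mul, map_neg, map_one]
    ring

lemma jp_eval_one (k : ℕ) : ∀ l : ℝ, 0 ≤ l →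
    (jp k l).eval 1 = (-2) ^ k * (Real.Gamma (k + l + 1) / Real.Gamma (l + 1)) := by
  induction k with
  | zero => 
    intro l hl
    have := (Real.Gamma_pos_of_pos (by linarith : 0 < l + 1)).ne'
    simp [jp, this]
  | succ k ih =>
    intro l hl
    have h := ih (l + 1) (by linarith)
    have h1 := (Real.Gamma_pos_of_pos (by linarith : 0 < l + 1)).ne'
    have h2 : Real.Gamma (l + 1 + 1) = (l + 1) * Real.Gamma (l + 1) :=
      Real.Gamma_add_one (by linarith)
    have h3 : l + 1 ≠ 0 := by linarith
    simp only [jp, Polynomial.eval_sub, Polynomial.eval_mul, h, h2, Polynomial.eval_one,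
      Polynomial.eval_X, Polynomial.eval_pow, Polynomial.eval_C]
    push_cast
    rw [show (k : ℝ) + 1 + l + 1 = k + (l + 1) + 1 by ring]
    field_simp
    ring

lemma poly_energy_bound (p : Polynomial ℝ) (l N : ℝ) (hl : 0 ≤ l) (hN : 0 < N)
    (hode : ∀ t : ℝ, (1 - t ^ 2) * p.derivative.derivative.eval t -
      2 * (l + 1) * t * p.derivative.eval t + N * p.eval t = 0)
    (M : ℝ) (h1 : |p.eval 1| = M) (h2 : |p.eval (-1)| = M) (t : ℝ) (ht : t ∈ Icc (-1 : ℝ) 1) :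
    |p.eval t| ≤ M := by
  have hM : 0 ≤ M := h1 ▸ abs_nonneg _
  set E : ℝ → ℝ := fun t => p.eval t ^ 2 + (1 - t ^ 2) * p.derivative.eval t ^ 2 / N with hE
  have hder : ∀ t, HasDerivAt E (2 * (2 * l + 1) / N * t * p.derivative.eval t ^ 2) t := by
    intro t
    have a := p.hasDerivAt t
    have b := p.derivative.hasDerivAt t
    have c := ((a.pow 2).add ((((hasDerivAt_id t).pow 2).const_sub 1).mul (b.pow 2) |>.div_const N))
    refine c.congr_deriv ?_
    simp
    have := hode t
    have h3 : (1 - t ^ 2) * p.derivative.derivative.eval t =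
      2 * (l + 1) * t * p.derivative.eval t - N * p.eval t := by linarith
    field_simp
    linear_combination (p.derivative.eval t) * this
  have hEb : E t ≤ M ^ 2 := by
    rcases le_total 0 t with h0 | h0
    · have hm : MonotoneOn E (Icc 0 1) := by
        apply monotoneOn_of_deriv_nonneg (convex_Icc 0 1)
        · exact fun x _ => (hder x).continuousAt.continuousWithinAt
        · exact fun x _ => (hder x).differentiableAt.differentiableWithinAt
        · intro x hx
          rw [interior_Icc] at hx
          rw [(hder x).deriv]
          have := hx.1
          positivity
      have := hm ⟨h0, ht.2⟩ (right_mem_Icc.2 zero_le_one) ht.2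
      have h4 : E 1 = M ^ 2 := by simp [hE, ← h1]
      linarith
    · have hm : AntitoneOn E (Icc (-1) 0) := by
        apply antitoneOn_of_deriv_nonpos (convex_Icc (-1) 0)
        · exact fun x _ => (hder x).continuousAt.continuousWithinAt
        · exact fun x _ => (hder x).differentiableAt.differentiableWithinAt
        · intro x hx
          rw [interior_Icc] at hx
          rw [(hder x).deriv]
          have h5 : 0 ≤ 2 * (2 * l + 1) / N * (-x) * p.derivative.eval x ^ 2 := by
            have : 0 ≤ -x := by linarith [hx.2]
            positivity
          linarith
      have := hm (left_mem_Icc.2 (by norm_num)) ⟨ht.1, h0⟩ ht.1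
      have h4 : E (-1) = M ^ 2 := by simp [hE, ← h2]
      linarith
  have h6 : 0 ≤ (1 - t ^ 2) * p.derivative.eval t ^ 2 / N := by
    have : 0 ≤ 1 - t ^ 2 := by nlinarith [ht.1, ht.2]
    positivity
  have h7 : p.eval t ^ 2 ≤ M ^ 2 := by
    simp only [hE] at hEb; linarith
  exact abs_le_of_sq_le_sq h7 hM

lemma jp_ode_eval (k : ℕ) (l t : ℝ) : (1 - t ^ 2) * (jp k l).derivative.derivative.eval t -
      2 * (l + 1) * t * (jp k l).derivative.eval t + eigN k l * (jp k l).eval t = 0 := by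
  have := congrArg (Polynomial.eval t) (jp_ode k l)
  simpa using this

/-- normalising constant -/
noncomputable def cN (k : ℕ) (l : ℝ) : ℝ :=
  (-1 / 2 : ℝ) ^ k * (Real.Gamma (l + 1) / Real.Gamma (k + l + 1))

lemma jp_bound (k : ℕ) (l : ℝ) (hl : 0 ≤ l) (t : ℝ) (ht : t ∈ Icc (-1 : ℝ) 1) :
    |cN k l * (jp k l).eval t| ≤ 1 := by
  have hG1 := (Real.Gamma_pos_of_pos (by linarith : 0 < l + 1))
  have hG2 := (Real.Gamma_pos_of_pos (by positivity : 0 < (k : ℝ) + l + 1))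
  have hc : |cN k l| * |(jp k l).eval 1| = 1 := by
    rw [← abs_mul, jp_eval_one k l hl, cN]
    have : (-1 / 2 : ℝ) ^ k * (-2) ^ k = 1 := by rw [← mul_pow]; norm_num
    rw [show (-1 / 2 : ℝ) ^ k * (Real.Gamma (l + 1) / Real.Gamma (k + l + 1)) *
      ((-2) ^ k * (Real.Gamma (k + l + 1) / Real.Gamma (l + 1))) =
      ((-1 / 2 : ℝ) ^ k * (-2) ^ k) * (Real.Gamma (l + 1) / Real.Gamma (k + l + 1) *
      (Real.Gamma (k + l + 1) / Real.Gamma (l + 1))) by ring, this]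
    field_simp
    simp
  rcases Nat.eq_zero_or_pos k with rfl | hk
  · simp [jp, cN, hG1.ne']
  have hN : 0 < eigN k l := by
    have : (0 : ℝ) < k := by exact_mod_cast hk
    unfold eigN; positivity
  have := poly_energy_bound (jp k l) l (eigN k l) hl hN (jp_ode_eval k l) _ rfl
    (by rw [jp_eval_neg, abs_mul]; simp) t ht
  rw [abs_mul, ← hc]
  gcongr

lemma W_pos {t : ℝ} (ht : t ∈ Ioo (-1 : ℝ) 1) : 0 < 1 - t ^ 2 := by nlinarith [ht.1, ht.2]

lemma hasDerivAt_W {t : ℝ} (ht : t ∈ Ioo (-1 : ℝ) 1) (a : ℝ) :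
    HasDerivAt (fun s : ℝ => (1 - s ^ 2) ^ (a + 1)) (-2 * (a + 1) * t * (1 - t ^ 2) ^ a) t := by
  have h := (((hasDerivAt_id t).pow 2).const_sub 1).rpow_const (p := a + 1)
    (Or.inl (by simpa using (W_pos ht).ne'))
  simp at h
  refine (h.congr_deriv ?_)
  ring

lemma W_succ {t : ℝ} (ht : t ∈ Ioo (-1 : ℝ) 1) (a : ℝ) :
    (1 - t ^ 2) ^ (a + 1) = (1 - t ^ 2) ^ a * (1 - t ^ 2) := by
  rw [Real.rpow_add (W_pos ht), Real.rpow_one]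

/-- first-order shift -/
lemma hasDerivAt_jp_shift (k : ℕ) (l : ℝ) {t : ℝ} (ht : t ∈ Ioo (-1 : ℝ) 1) :
    HasDerivAt (fun s : ℝ => (1 - s ^ 2) ^ (l + 1) * (jp k (l + 1)).eval s)
      ((1 - t ^ 2) ^ l * (jp (k + 1) l).eval t) t := by
  refine ((hasDerivAt_W ht l).mul ((jp k (l + 1)).hasDerivAt t)).congr_deriv ?_
  rw [W_succ ht]
  simp [jp]
  ring

lemma iteratedDeriv_W (k : ℕ) : ∀ l : ℝ, ∀ t ∈ Ioo (-1 : ℝ) 1,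
    iteratedDeriv k (fun s : ℝ => (1 - s ^ 2) ^ ((k : ℝ) + l)) t =
      (1 - t ^ 2) ^ l * (jp k l).eval t := by
  induction k with
  | zero => intro l t ht; simp [jp]
  | succ k ih =>
    intro l t ht
    rw [iteratedDeriv_succ, show (fun s : ℝ => (1 - s ^ 2) ^ (((k + 1 : ℕ) : ℝ) + l)) =
      (fun s : ℝ => (1 - s ^ 2) ^ ((k : ℝ) + (l + 1))) by
        funext s; congr 1; push_cast; ring]
    rw [← (hasDerivAt_jp_shift k l ht).deriv]
    apply Filter.EventuallyEq.deriv_eq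
    filter_upwards [Ioo_mem_nhds ht.1 ht.2] with s hs
    exact ih (l + 1) s hs

/-- normalised coefficient functional -/
noncomputable def TT (k : ℕ) (l : ℝ) (f : ℝ → ℝ) : ℝ :=
  cN k l * ∫ t in (-1 : ℝ)..1, f t * ((1 - t ^ 2) ^ l * (jp k l).eval t)

lemma legendreCoeff_eq (d k : ℕ) (f : ℝ → ℝ) :
    legendreCoeff d k f = (sphereSurface (d - 1) / sphereSurface d) *
      TT k (((d : ℝ) - 3) / 2) f := by
  unfold legendreCoeff TT
  congr 1
  rw [← intervalIntegral.integral_const_mul]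
  rw [intervalIntegral.integral_of_le (by norm_num), intervalIntegral.integral_of_le (by norm_num),
    MeasureTheory.integral_Ioc_eq_integral_Ioo, MeasureTheory.integral_Ioc_eq_integral_Ioo]
  apply MeasureTheory.setIntegral_congr_fun measurableSet_Ioo
  intro t ht
  simp only [legendreP]
  rw [iteratedDeriv_W k _ t ht, cN]
  have h1 : (1 - t ^ 2) ^ ((3 - (d : ℝ)) / 2) * (1 - t ^ 2) ^ (((d : ℝ) - 3) / 2) = 1 := by
    rw [← Real.rpow_add (W_pos ht)]
    rw [show (3 - (d : ℝ)) / 2 + ((d : ℝ) - 3) / 2 = 0 by ring, Real.rpow_zero]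
  rw [show ((d : ℝ) - 1) / 2 = ((d : ℝ) - 3) / 2 + 1 by ring, ← add_assoc]
  linear_combination (f t * ((-1 / 2) ^ k * (Real.Gamma (((d : ℝ) - 3) / 2 + 1) / Real.Gamma ((k:ℝ) + ((d : ℝ) - 3) / 2 + 1))) *
    ((1 - t ^ 2) ^ (((d : ℝ) - 3) / 2) * (jp k (((d : ℝ) - 3) / 2)).eval t)) * h1

lemma TT_neg (k : ℕ) (l : ℝ) (f : ℝ → ℝ) : TT k l (fun t => f (-t)) = (-1) ^ k * TT k l f := by
  unfold TT
  have := intervalIntegral.integral_comp_neg (a := (-1 : ℝ)) (b := 1)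
    (fun t => f t * ((1 - t ^ 2) ^ l * (jp k l).eval (-t)))
  simp only [neg_neg, neg_sq] at this
  rw [this]
  simp_rw [jp_eval_neg]
  rw [show (fun t => f t * ((1 - t ^ 2) ^ l * ((-1) ^ k * (jp k l).eval t))) =
    fun t => (-1) ^ k * (f t * ((1 - t ^ 2) ^ l * ((jp k l).eval t))) by funext t; ring]
  rw [intervalIntegral.integral_const_mul]
  ring


lemma half_integrable (h : ℝ → ℝ) (σ : ℝ) (hσ : -1 < σ) (hc : ContinuousOn h (Ioo (-1) 1))
    (h1 : h =O[𝓝[<] 1] fun t => (1 - t) ^ σ) : IntervalIntegrable h MeasureTheory.volume 0 1 := by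
  obtain ⟨C, hC⟩ := h1.bound
  rw [eventually_nhdsWithin_iff, Metric.eventually_nhds_iff] at hC
  obtain ⟨ε, hε, hb⟩ := hC
  set a : ℝ := max 0 (1 - ε / 2) with ha
  have ha0 : 0 ≤ a := le_max_left _ _
  have ha1 : a < 1 := max_lt one_pos (by linarith)
  have i1 : IntervalIntegrable h MeasureTheory.volume 0 a := by
    apply ContinuousOn.intervalIntegrable
    apply hc.mono
    rw [uIcc_of_le ha0]
    intro x hx
    exact ⟨by linarith [hx.1], by linarith [hx.2]⟩
  refine i1.trans ?_
  have i2 : IntervalIntegrable (fun t : ℝ => C * (1 - t) ^ σ) MeasureTheory.volume a 1 := by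
    apply IntervalIntegrable.const_mul
    have := (intervalIntegral.intervalIntegrable_rpow' (a := 0) (b := 1 - a) hσ).comp_sub_left 1
    simpa using this.symm
  refine i2.mono_fun' ?_ ?_
  · rw [uIoc_of_le ha1.le, ← MeasureTheory.Measure.restrict_congr_set MeasureTheory.Ioo_ae_eq_Ioc]
    apply ContinuousOn.aestronglyMeasurable _ measurableSet_Ioo
    exact hc.mono (Ioo_subset_Ioo (by linarith) le_rfl)
  · rw [uIoc_of_le ha1.le, ← MeasureTheory.Measure.restrict_congr_set MeasureTheory.Ioo_ae_eq_Ioc]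
    filter_upwards [MeasureTheory.ae_restrict_mem measurableSet_Ioo] with t ht
    have h3 : 1 - ε / 2 ≤ a := le_max_right _ _
    have := hb (y := t) (by rw [Real.dist_eq, abs_lt]; constructor <;> linarith [ht.1, ht.2]) ht.2
    have h4 : 0 ≤ (1 - t) ^ σ := Real.rpow_nonneg (by linarith [ht.2]) _
    rwa [Real.norm_of_nonneg h4] at this

lemma full_integrable (h : ℝ → ℝ) (σ : ℝ) (hσ : -1 < σ) (hc : ContinuousOn h (Ioo (-1) 1))
    (h1 : h =O[𝓝[<] 1] fun t => (1 - t) ^ σ)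
    (h2 : (fun t => h (-t)) =O[𝓝[<] 1] fun t => (1 - t) ^ σ) :
    IntervalIntegrable h MeasureTheory.volume (-1) 1 := by
  have i1 := half_integrable h σ hσ hc h1
  have i2 := half_integrable (fun t => h (-t)) σ hσ (hc.comp (by fun_prop) (by
    intro x hx; exact ⟨by linarith [hx.2], by linarith [hx.1]⟩)) h2
  have i3 := (IntervalIntegrable.iff_comp_neg).1 i2
  simp at i3
  exact i3.symm.trans i1

lemma integrable_pm (a b : ℝ) (ha : -1 < a) (hb : -1 < b) :
    IntervalIntegrable (fun t : ℝ => (1 - t) ^ a * (1 + t) ^ b) MeasureTheory.volume (-1) 1 := by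
  have key : ∀ a b : ℝ, -1 < a → 
      IntervalIntegrable (fun t : ℝ => (1 - t) ^ a * (1 + t) ^ b) MeasureTheory.volume 0 1 := by
    intro a b ha
    apply half_integrable _ a ha
    · apply ContinuousOn.mul
      · apply ContinuousOn.rpow_const (by fun_prop)
        intro x hx; left; linarith [hx.2]
      · apply ContinuousOn.rpow_const (by fun_prop)
        intro x hx; left; linarith [hx.1]
    · have : (fun t : ℝ => (1 + t) ^ b) =O[𝓝[<] 1] fun _ => (1 : ℝ) := by
        refine Tendsto.isBigO_one ℝ (c := (1 + 1 : ℝ) ^ b) ?_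
        apply Tendsto.mono_left _ nhdsWithin_le_nhds
        apply ContinuousAt.tendsto (f := fun t : ℝ => (1 + t) ^ b)
        exact ContinuousAt.rpow_const (by fun_prop) (Or.inl (by norm_num))
      simpa using (isBigO_refl (fun t : ℝ => (1 - t) ^ a) (𝓝[<] 1)).mul this
  have i1 := key a b ha
  have i2 := (IntervalIntegrable.iff_comp_neg).1 (key b a hb)
  simp at i2
  have i4 : IntervalIntegrable (fun t : ℝ => (1 - t) ^ a * (1 + t) ^ b) MeasureTheory.volume 0 (-1) := by
    convert i2 using 2 with t
    rw [mul_comm]; congr 2 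
  exact i4.symm.trans i1

/-- Beta integral on [-1,1]. -/
noncomputable def BB (a b : ℝ) : ℝ :=
  2 ^ (a + b + 1) * (Real.Gamma (a + 1) * Real.Gamma (b + 1) / Real.Gamma (a + b + 2))

lemma integral_pm (a b : ℝ) (ha : -1 < a) (hb : -1 < b) :
    ∫ t in (-1 : ℝ)..1, (1 - t) ^ a * (1 + t) ^ b = BB a b := by
  have h0 := ProbabilityTheory.beta_eq_betaIntegralReal (a + 1) (b + 1) (by linarith) (by linarith)
  rw [ProbabilityTheory.beta, Complex.betaIntegral] at h0
  have h1 : ∫ x : ℝ in (0 : ℝ)..1, (x : ℂ) ^ (((a + 1 : ℝ) : ℂ) - 1) * (1 - (x : ℂ)) ^ (((b + 1 : ℝ) : ℂ) - 1)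
      = ((∫ x : ℝ in (0 : ℝ)..1, x ^ a * (1 - x) ^ b : ℝ) : ℂ) := by
    rw [← intervalIntegral.integral_ofReal]
    apply intervalIntegral.integral_congr
    intro x hx
    rw [uIcc_of_le zero_le_one] at hx
    simp only
    push_cast
    rw [Complex.ofReal_cpow hx.1, Complex.ofReal_cpow (by linarith [hx.2])]
    push_cast
    ring_nf
  rw [h1, Complex.ofReal_re] at h0
  have h2 := intervalIntegral.integral_comp_mul_add (a := (-1 : ℝ)) (b := 1)
    (fun x : ℝ => x ^ a * (1 - x) ^ b) (c := -1/2) (by norm_num) (1 / 2)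
  norm_num at h2
  rw [intervalIntegral.integral_symm (0 : ℝ) 1, ← h0] at h2
  unfold BB
  have h3 : ∫ t in (-1 : ℝ)..1, (1 - t) ^ a * (1 + t) ^ b =
      ∫ t in (-1 : ℝ)..1, 2 ^ (a + b) * ((-(1 / 2 * t) + 1 / 2) ^ a * (1 - (-(1 / 2 * t) + 1 / 2)) ^ b) := by
    apply intervalIntegral.integral_congr
    intro x hx
    rw [uIcc_of_le (by norm_num)] at hx
    simp only
    rw [Real.rpow_add two_pos]
    rw [show (1 - x) = 2 * (-(1 / 2 * x) + 1 / 2) by ring,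
      show (1 + x) = 2 * (1 - (-(1 / 2 * x) + 1 / 2)) by ring,
      Real.mul_rpow (by norm_num) (by linarith [hx.2]),
      Real.mul_rpow (by norm_num) (by linarith [hx.1])]
    ring
  rw [h3, intervalIntegral.integral_const_mul]
  rw [show (fun t : ℝ => (-(1 / 2 * t) + 1 / 2) ^ a * (1 - (-(1 / 2 * t) + 1 / 2)) ^ b) =
    (fun x : ℝ => (-(1 / 2 * x) + 1 / 2) ^ a * (1 - (-(1 / 2 * x) + 1 / 2)) ^ b) from rfl, h2]
  rw [show a + 1 + (b + 1) = a + b + 2 by ring, show (2 : ℝ) ^ (a + b + 1) = 2 ^ (a + b) * 2 by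
    rw [Real.rpow_add two_pos, Real.rpow_one]]
  ring

lemma W_rpow {t : ℝ} (ht : t ∈ Ioo (-1 : ℝ) 1) (l : ℝ) :
    (1 - t ^ 2) ^ l = (1 - t) ^ l * (1 + t) ^ l := by
  rw [← Real.mul_rpow (by linarith [ht.2]) (by linarith [ht.1])]
  congr 1; ring

lemma intervalIntegrable_congr_Ioo {f g : ℝ → ℝ} (h : ∀ t ∈ Ioo (-1 : ℝ) 1, f t = g t)
    (hg : IntervalIntegrable g MeasureTheory.volume (-1) 1) :
    IntervalIntegrable f MeasureTheory.volume (-1) 1 := by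
  rw [intervalIntegrable_iff_integrableOn_Ioo_of_le (by norm_num)] at hg ⊢
  exact hg.congr_fun (fun t ht => (h t ht).symm) measurableSet_Ioo

lemma integral_congr_Ioo' {f g : ℝ → ℝ} (h : ∀ t ∈ Ioo (-1 : ℝ) 1, f t = g t) :
    ∫ t in (-1 : ℝ)..1, f t = ∫ t in (-1 : ℝ)..1, g t := by
  rw [intervalIntegral.integral_of_le (by norm_num), intervalIntegral.integral_of_le (by norm_num),
    MeasureTheory.integral_Ioc_eq_integral_Ioo, MeasureTheory.integral_Ioc_eq_integral_Ioo]
  exact MeasureTheory.setIntegral_congr_fun measurableSet_Ioo h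

lemma pow_form {t : ℝ} (ht : t ∈ Ioo (-1 : ℝ) 1) (n l c : ℝ) :
    (1 - t) ^ n * ((1 - t ^ 2) ^ l * c) = (1 - t) ^ (n + l) * (1 + t) ^ l * c := by
  rw [W_rpow ht, Real.rpow_add (by linarith [ht.2])]
  ring

lemma integrable_model (n l : ℝ) (hl : -1 < l) (hn : -1 < n + l) (p : Polynomial ℝ) :
    IntervalIntegrable (fun t : ℝ => (1 - t) ^ n * ((1 - t ^ 2) ^ l * p.eval t))
      MeasureTheory.volume (-1) 1 := by
  apply intervalIntegrable_congr_Ioo (fun t ht => pow_form ht n l _)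
  exact (integrable_pm _ _ hn hl).mul_continuousOn p.continuous.continuousOn

lemma model_shift (n l : ℝ) (hl : -1 < l) (hn : -1 < n + l) (k : ℕ) :
    ∫ t in (-1 : ℝ)..1, (1 - t) ^ n * ((1 - t ^ 2) ^ l * (jp (k + 1) l).eval t) =
    n * ∫ t in (-1 : ℝ)..1, (1 - t) ^ (n - 1) * ((1 - t ^ 2) ^ (l + 1) * (jp k (l + 1)).eval t) := by
  have i1 := integrable_model n l hl hn (jp (k + 1) l)
  have i2 := integrable_model (n - 1) (l + 1) (by linarith) (by linarith) (jp k (l + 1))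
  have hcont : Continuous (fun t : ℝ => (1 - t) ^ (n + (l + 1)) * (1 + t) ^ (l + 1) *
      (jp k (l + 1)).eval t) := by
    refine (Continuous.mul ?_ ?_).mul (jp k (l + 1)).continuous
    · exact (Continuous.rpow_const (by fun_prop) (fun _ => Or.inr (by linarith)))
    · exact (Continuous.rpow_const (by fun_prop) (fun _ => Or.inr (by linarith)))
  have h1 : 0 < n + (l + 1) := by linarith
  have h2 : 0 < l + 1 := by linarith
  have := intervalIntegral.integral_eq_sub_of_hasDerivAt_of_tendsto (a := (-1 : ℝ)) (b := 1)
    (f := fun t => (1 - t) ^ n * ((1 - t ^ 2) ^ (l + 1) * (jp k (l + 1)).eval t))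
    (f' := fun t => (1 - t) ^ n * ((1 - t ^ 2) ^ l * (jp (k + 1) l).eval t) -
      n * ((1 - t) ^ (n - 1) * ((1 - t ^ 2) ^ (l + 1) * (jp k (l + 1)).eval t)))
    (fa := 0) (fb := 0) (by norm_num) ?_ (i1.sub (i2.const_mul n)) ?_ ?_
  · rw [intervalIntegral.integral_sub i1 (i2.const_mul n), intervalIntegral.integral_const_mul] at this
    linarith
  · intro t ht
    have a := ((hasDerivAt_id t).const_sub 1).rpow_const (p := n)
      (Or.inl (by simp; linarith [ht.2]))
    refine (a.mul (hasDerivAt_jp_shift k l ht)).congr_deriv ?_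
    simp; ring
  · have h3 := hcont.tendsto (-1)
    simp [Real.zero_rpow h2.ne'] at h3
    refine Tendsto.congr' ?_ (h3.mono_left nhdsWithin_le_nhds)
    filter_upwards [Ioo_mem_nhdsGT (show (-1 : ℝ) < 1 by norm_num)] with t ht
    exact (pow_form ht n (l + 1) _).symm
  · have h3 := hcont.tendsto 1
    simp [Real.zero_rpow h1.ne'] at h3
    refine Tendsto.congr' ?_ (h3.mono_left nhdsWithin_le_nhds)
    filter_upwards [Ioo_mem_nhdsLT (show (-1 : ℝ) < 1 by norm_num)] with t ht
    exact (pow_form ht n (l + 1) _).symm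

lemma model_exact (k : ℕ) : ∀ (n l : ℝ) (_ : -1 < l) (_ : -1 < n + l),
    ∫ t in (-1 : ℝ)..1, (1 - t) ^ n * ((1 - t ^ 2) ^ l * (jp k l).eval t) =
    (∏ j ∈ Finset.range k, (n - j)) * BB (n + l) (l + k) := by
  induction k with
  | zero => 
    intro n l hl hn
    simp only [Finset.range_zero, Finset.prod_empty, one_mul, Nat.cast_zero, add_zero]
    rw [← integral_pm _ _ hn hl]
    apply integral_congr_Ioo'
    intro t ht
    rw [pow_form ht]; simp [jp]
  | succ k ih =>
    intro n l hl hn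
    rw [model_shift n l hl hn, ih _ _ (by linarith) (by linarith), Finset.prod_range_succ']
    push_cast
    rw [show n - 1 + (l + 1) = n + l by ring, show l + 1 + k = l + (k + 1) by ring,
      show (∏ j ∈ Finset.range k, (n - 1 - (j : ℝ))) = ∏ j ∈ Finset.range k, (n - (j + 1 : ℝ)) by
        apply Finset.prod_congr rfl; intros; ring]
    ring


lemma Gamma_add_prod (z : ℝ) (hz : 0 < z) (n : ℕ) :
    Real.Gamma (z + n) = Real.Gamma z * ∏ j ∈ Finset.range n, (z + j) := by
  induction n with
  | zero => simp
  | succ n ih =>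
    rw [Finset.prod_range_succ, ← mul_assoc, ← ih]
    push_cast
    rw [← add_assoc, Real.Gamma_add_one (by positivity)]
    ring

/-- limit constant of the model functions -/
noncomputable def DD (n l : ℝ) : ℝ :=
  2 ^ (n + 2 * l + 1) * Real.Gamma (l + 1) * Real.Gamma (n + l + 1) / Real.Gamma (-n)

lemma TT_model (k : ℕ) (n l : ℝ) (hl : 0 ≤ l) (hn : 0 ≤ n) :
    TT k l (fun t => (1 - t) ^ n) = 2 ^ (n + 2 * l + 1) * Real.Gamma (l + 1) *
      Real.Gamma (n + l + 1) * ((∏ j ∈ Finset.range k, (-n + j)) / 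
      Real.Gamma (n + 2 * l + 2 + k)) := by
  unfold TT
  rw [model_exact k n l (by linarith) (by linarith), cN, BB]
  have h1 : (2 : ℝ) ^ (n + l + (l + k) + 1) = 2 ^ (n + 2 * l + 1) * 2 ^ k := by
    rw [← Real.rpow_natCast, ← Real.rpow_add two_pos]; congr 1; ring
  have h2 : (∏ j ∈ Finset.range k, (-n + (j : ℝ))) = (-1) ^ k * ∏ j ∈ Finset.range k, (n - j) := by
    rw [show ((-1 : ℝ) ^ k) = ∏ j ∈ Finset.range k, (-1 : ℝ) by simp, ← Finset.prod_mul_distrib]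
    apply Finset.prod_congr rfl; intros; ring
  have h3 := (Real.Gamma_pos_of_pos (by positivity : 0 < (k : ℝ) + l + 1)).ne'
  rw [h1, h2, show l + k + 1 = (k : ℝ) + l + 1 by ring,
    show n + l + (l + k) + 2 = n + 2 * l + 2 + k by ring]
  have h4 : (-1 / 2 : ℝ) ^ k = (-1) ^ k / 2 ^ k := by rw [div_pow]
  rw [h4]
  field_simp

lemma TT_model_nat (k m : ℕ) (l : ℝ) (hl : 0 ≤ l) (hk : m < k) :
    TT k l (fun t => (1 - t) ^ (m : ℝ)) = 0 := by
  rw [TT_model k m l hl (by positivity)]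
  rw [Finset.prod_eq_zero (Finset.mem_range.2 hk) (by ring)]
  simp

lemma TT_model_tendsto (n l : ℝ) (hl : 0 ≤ l) (hn : 0 ≤ n) (hnat : ∀ m : ℕ, n ≠ m) :
    Tendsto (fun k : ℕ => TT k l (fun t => (1 - t) ^ n) * (k : ℝ) ^ (2 * n + 2 * l + 2))
      atTop (𝓝 (DD n l)) := by
  rw [← tendsto_add_atTop_iff_nat 1]
  set z := n + 2 * l + 2 with hz
  have hzp : 0 < z := by positivity
  have hGz := (Real.Gamma_pos_of_pos hzp).ne'
  have hGn : Real.Gamma (-n) ≠ 0 := Real.Gamma_ne_zero (fun m h => hnat m (by linarith))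
  have hlim : Tendsto (fun m : ℕ => (2 ^ (n + 2 * l + 1) * Real.Gamma (l + 1) *
      Real.Gamma (n + l + 1)) * (Real.GammaSeq z m / Real.GammaSeq (-n) m / Real.Gamma z *
      (((m + 1 : ℕ) : ℝ) / (m : ℝ)) ^ (2 * n + 2 * l + 2))) atTop (𝓝 (DD n l)) := by
    have h1 : Tendsto (fun m : ℕ => ((m + 1 : ℕ) : ℝ) / (m : ℝ)) atTop (𝓝 1) := by
      have : Tendsto (fun m : ℕ => 1 + 1 / (m : ℝ)) atTop (𝓝 (1 + 0)) :=
        tendsto_const_nhds.add tendsto_one_div_atTop_nhds_zero_nat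
      rw [add_zero] at this
      refine this.congr' ?_
      filter_upwards [eventually_gt_atTop 0] with m hm
      have : (0 : ℝ) < m := by exact_mod_cast hm
      push_cast; field_simp
    have h2 := h1.rpow_const (p := 2 * n + 2 * l + 2) (Or.inl one_ne_zero)
    have h3 := (((Real.GammaSeq_tendsto_Gamma z).div (Real.GammaSeq_tendsto_Gamma (-n)) hGn).div_const
      (Real.Gamma z)).mul h2
    have h4 := h3.const_mul (2 ^ (n + 2 * l + 1) * Real.Gamma (l + 1) * Real.Gamma (n + l + 1))
    have h5 : DD n l = 2 ^ (n + 2 * l + 1) * Real.Gamma (l + 1) * Real.Gamma (n + l + 1) *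
        (Real.Gamma z / Real.Gamma (-n) / Real.Gamma z * 1 ^ (2 * n + 2 * l + 2)) := by
      rw [Real.one_rpow, DD]
      field_simp
    rw [h5]
    exact h4
  refine hlim.congr' ?_
  filter_upwards [eventually_gt_atTop 0] with m hm
  have hm0 : (0 : ℝ) < m := by exact_mod_cast hm
  rw [TT_model _ n l hl hn, ← hz, Gamma_add_prod z hzp, Real.GammaSeq, Real.GammaSeq]
  have p1 : (∏ j ∈ Finset.range (m + 1), (z + (j : ℝ))) ≠ 0 :=
    Finset.prod_ne_zero_iff.2 (fun j _ => by positivity)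
  have p2 : (∏ j ∈ Finset.range (m + 1), (-n + (j : ℝ))) ≠ 0 :=
    Finset.prod_ne_zero_iff.2 (fun j _ h => hnat j (by linarith))
  have p3 : (m.factorial : ℝ) ≠ 0 := by positivity
  rw [Real.div_rpow (by positivity) hm0.le]
  have p4 : (m : ℝ) ^ z = (m : ℝ) ^ (-n) * (m : ℝ) ^ (2 * n + 2 * l + 2) := by
    rw [← Real.rpow_add hm0]; congr 1; rw [hz]; ring
  have p5 : (m : ℝ) ^ (-n) ≠ 0 := (Real.rpow_pos_of_pos hm0 _).ne'
  have p6 : (m : ℝ) ^ (2 * n + 2 * l + 2) ≠ 0 := (Real.rpow_pos_of_pos hm0 _).ne'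
  rw [p4]
  generalize (∏ j ∈ Finset.range (m + 1), (z + (j : ℝ))) = A at *
  generalize (∏ j ∈ Finset.range (m + 1), (-n + (j : ℝ))) = B at *
  generalize (m : ℝ) ^ (2 * n + 2 * l + 2) = Cc at *
  generalize (m : ℝ) ^ (-n) = Dd at *
  field_simp

lemma TT_model_zero (n l e : ℝ) (hl : 0 ≤ l) (hn : 0 ≤ n)
    (he : e < 2 * n + 2 * l + 2 ∨ ∃ m : ℕ, n = m) :
    Tendsto (fun k : ℕ => TT k l (fun t => (1 - t) ^ n) * (k : ℝ) ^ e) atTop (𝓝 0) := by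
  by_cases hnat : ∃ m : ℕ, n = m
  · obtain ⟨m, rfl⟩ := hnat
    refine tendsto_const_nhds.congr' ?_
    filter_upwards [eventually_gt_atTop m] with k hk
    rw [TT_model_nat k m l hl hk, zero_mul]
  · have he' := he.resolve_right hnat
    push Not at hnat
    have h1 := TT_model_tendsto n l hl hn hnat
    have h2 : Tendsto (fun k : ℕ => (k : ℝ) ^ (-(2 * n + 2 * l + 2 - e))) atTop (𝓝 0) :=
      (tendsto_rpow_neg_atTop (by linarith)).comp tendsto_natCast_atTop_atTop
    have h3 := h1.mul h2
    rw [mul_zero] at h3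
    refine h3.congr' ?_
    filter_upwards [eventually_gt_atTop 0] with k hk
    have hk0 : (0 : ℝ) < k := by exact_mod_cast hk
    rw [mul_assoc, ← Real.rpow_add hk0]
    congr 2; ring


/-- `g` behaves like `y ^ n * R y` near `1`, where `t = 1 - y ^ 2` and `R` is analytic. -/
def QQ (n : ℤ) (g : ℝ → ℝ) : Prop :=
  ∃ R : ℝ → ℝ, AnalyticAt ℝ R 0 ∧ ∀ᶠ y in 𝓝[>] (0 : ℝ), g (1 - y ^ 2) = y ^ n * R y

lemma QQ.add {n : ℤ} {g h : ℝ → ℝ} (hg : QQ n g) (hh : QQ n h) : QQ n (fun t => g t + h t) := by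
  obtain ⟨R, hR, h1⟩ := hg
  obtain ⟨S, hS, h2⟩ := hh
  refine ⟨fun y => R y + S y, by fun_prop, ?_⟩
  filter_upwards [h1, h2] with y a b
  rw [a, b]; ring

lemma QQ.mul {n m : ℤ} {g h : ℝ → ℝ} (hg : QQ n g) (hh : QQ m h) :
    QQ (n + m) (fun t => g t * h t) := by
  obtain ⟨R, hR, h1⟩ := hg
  obtain ⟨S, hS, h2⟩ := hh
  refine ⟨fun y => R y * S y, by fun_prop, ?_⟩
  filter_upwards [h1, h2, self_mem_nhdsWithin] with y a b c
  rw [a, b, zpow_add₀ (ne_of_gt c)]; ring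

lemma QQ.const_mul {n : ℤ} {g : ℝ → ℝ} (hg : QQ n g) (c : ℝ) : QQ n (fun t => c * g t) := by
  obtain ⟨R, hR, h1⟩ := hg
  refine ⟨fun y => c * R y, by fun_prop, ?_⟩
  filter_upwards [h1] with y a
  rw [a]; ring

lemma QQ_one_sub_sq : QQ 2 (fun t => 1 - t ^ 2) := by
  refine ⟨fun y => 2 - y ^ 2, by fun_prop, Eventually.of_forall fun y => ?_⟩
  simp only [zpow_ofNat]; ring

lemma QQ_id : QQ 0 (fun t => t) := by
  refine ⟨fun y => 1 - y ^ 2, by fun_prop, Eventually.of_forall fun y => ?_⟩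
  simp

lemma QQ.deriv {n : ℤ} {g : ℝ → ℝ} (hg : QQ n g) (ha : AnalyticOnNhd ℝ g (Ioo (-1) 1)) :
    QQ (n - 2) (deriv g) := by
  obtain ⟨R, hR, h1⟩ := hg
  refine ⟨fun y => -(n * R y + y * _root_.deriv R y) / 2, ?_, ?_⟩
  · have := hR.deriv
    fun_prop
  have h2 := eventually_eventually_nhdsWithin.2 h1
  have h3 : ∀ᶠ y in 𝓝[>] (0 : ℝ), AnalyticAt ℝ R y := hR.eventually_analyticAt.filter_mono nhdsWithin_le_nhds
  filter_upwards [h2, h3, self_mem_nhdsWithin, Ioo_mem_nhdsGT one_pos] with y a b c d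
  have c' : 0 < y := c
  rw [isOpen_Ioi.nhdsWithin_eq c] at a
  have hin : 1 - y ^ 2 ∈ Ioo (-1 : ℝ) 1 := ⟨by nlinarith [d.2], by nlinarith⟩
  have e1 : HasDerivAt (fun y => g (1 - y ^ 2)) (_root_.deriv g (1 - y ^ 2) * (-(2 * y))) y := by
    have := (((hasDerivAt_id y).pow 2).const_sub 1)
    have h5 := (ha _ hin).differentiableAt.hasDerivAt
    refine (HasDerivAt.comp (h₂ := g) (h₂' := _root_.deriv g (1 - y ^ 2)) y h5 this).congr_deriv ?_
    simp
  have e2 : HasDerivAt (fun y => y ^ n * R y) (n * y ^ (n - 1) * R y + y ^ n * _root_.deriv R y) y :=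
    (hasDerivAt_zpow n y (Or.inl c'.ne')).mul b.differentiableAt.hasDerivAt
  have e3 := e1.unique (e2.congr_of_eventuallyEq a)
  have z1 : y ^ n = y ^ (n - 2) * y ^ 2 := by
    rw [← zpow_natCast, ← zpow_add₀ c'.ne']; congr 1; simp
  have z2 : y ^ (n - 1) = y ^ (n - 2) * y := by
    rw [← zpow_add_one₀ c'.ne']; congr 1; ring
  rw [z1, z2] at e3
  have : y * (_root_.deriv g (1 - y ^ 2)) = y * (y ^ (n - 2) * (-(n * R y + y * _root_.deriv R y) / 2)) := by
    linear_combination (-1 / 2) * e3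
  exact mul_left_cancel₀ c'.ne' this

lemma QQ.isBigO {n : ℤ} {g : ℝ → ℝ} (hg : QQ n g) :
    g =O[𝓝[<] 1] fun t => (1 - t) ^ ((n : ℝ) / 2) := by
  obtain ⟨R, hR, h1⟩ := hg
  have ht : Tendsto (fun t : ℝ => Real.sqrt (1 - t)) (𝓝[<] 1) (𝓝[>] 0) := by
    apply tendsto_nhdsWithin_of_tendsto_nhds_of_eventually_within
    · have : Continuous (fun t : ℝ => Real.sqrt (1 - t)) := by fun_prop
      have := this.tendsto 1
      simp at this
      exact this.mono_left nhdsWithin_le_nhds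
    · filter_upwards [self_mem_nhdsWithin] with t ht
      exact Real.sqrt_pos.2 (by simpa using ht)
  have hb : (fun t : ℝ => R (Real.sqrt (1 - t))) =O[𝓝[<] 1] fun _ => (1 : ℝ) := by
    refine Tendsto.isBigO_one ℝ (c := R 0) ?_
    exact (hR.continuousAt.tendsto.mono_left nhdsWithin_le_nhds).comp ht
  have := (isBigO_refl (fun t : ℝ => (1 - t) ^ ((n : ℝ) / 2)) (𝓝[<] 1)).mul hb
  simp only [mul_one] at this
  refine IsBigO.congr' this ?_ EventuallyEq.rfl
  filter_upwards [ht.eventually h1, self_mem_nhdsWithin] with t h2 h3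
  have h3' : 0 ≤ 1 - t := by simp at h3; linarith
  rw [Real.sq_sqrt h3', sub_sub_cancel] at h2
  rw [h2, ← Real.rpow_intCast, Real.sqrt_eq_rpow, ← Real.rpow_mul h3']
  congr 2; ring

structure Nice (n : ℤ) (g : ℝ → ℝ) : Prop where
  an : AnalyticOnNhd ℝ g (Ioo (-1) 1)
  r : QQ n g
  l : QQ n (fun t => g (-t))

/-- the Gegenbauer operator -/
noncomputable def MM (l : ℝ) (g : ℝ → ℝ) (t : ℝ) : ℝ :=
  (1 - t ^ 2) * deriv (deriv g) t - 2 * (l + 1) * (t * deriv g t)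

lemma MM_neg (l : ℝ) (g : ℝ → ℝ) : (fun t => MM l g (-t)) = MM l (fun t => g (-t)) := by
  funext t
  unfold MM
  have h1 : deriv (fun t => g (-t)) = fun t => - deriv g (-t) := by
    funext t; exact deriv_comp_neg _ _
  have h2 : deriv (deriv (fun t => g (-t))) t = deriv (deriv g) (-t) := by
    rw [h1]
    rw [deriv.fun_neg, deriv_comp_neg]; ring
  rw [h2, h1]; simp

lemma QQ.MM {n : ℤ} {g : ℝ → ℝ} (hg : QQ n g) (ha : AnalyticOnNhd ℝ g (Ioo (-1) 1)) (l : ℝ) :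
    QQ (n - 2) (MM l g) := by
  have h1 := hg.deriv ha
  have h2 := h1.deriv ha.deriv
  have a := QQ_one_sub_sq.mul h2
  have b := (QQ_id.mul h1).const_mul (-(2 * (l + 1)))
  rw [show (2 : ℤ) + (n - 2 - 2) = n - 2 by ring] at a
  rw [show (0 : ℤ) + (n - 2) = n - 2 by ring] at b
  have c := a.add b
  convert c using 2 with t
  rw [_root_.MM]; ring

lemma neg_mem_Ioo' {t : ℝ} (ht : t ∈ Ioo (-1 : ℝ) 1) : -t ∈ Ioo (-1 : ℝ) 1 :=
  ⟨by linarith [ht.2], by linarith [ht.1]⟩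

lemma analytic_neg {g : ℝ → ℝ} (ha : AnalyticOnNhd ℝ g (Ioo (-1) 1)) :
    AnalyticOnNhd ℝ (fun t => g (-t)) (Ioo (-1) 1) := by
  intro t ht
  exact (ha _ (neg_mem_Ioo' ht)).fun_comp (f := fun t : ℝ => -t) (by fun_prop)

lemma Nice.MM {n : ℤ} {g : ℝ → ℝ} (hg : Nice n g) (l : ℝ) : Nice (n - 2) (MM l g) := by
  refine ⟨?_, hg.r.MM hg.an l, ?_⟩
  · intro t ht
    have h1 := hg.an.deriv t ht
    have h2 := hg.an.deriv.deriv t ht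
    unfold _root_.MM
    fun_prop
  · rw [MM_neg]
    exact hg.l.MM (analytic_neg hg.an) l

lemma Nice.neg {n : ℤ} {g : ℝ → ℝ} (hg : Nice n g) : Nice n (fun t => g (-t)) :=
  ⟨analytic_neg hg.an, hg.l, by simpa using hg.r⟩

lemma W_isBigO (a : ℝ) : (fun t : ℝ => (1 - t ^ 2) ^ a) =O[𝓝[<] 1] fun t => (1 - t) ^ a := by
  have : (fun t : ℝ => (1 + t) ^ a) =O[𝓝[<] 1] fun _ => (1 : ℝ) := by
    refine Tendsto.isBigO_one ℝ (c := (1 + 1 : ℝ) ^ a) ?_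
    apply Tendsto.mono_left _ nhdsWithin_le_nhds
    apply ContinuousAt.tendsto (f := fun t : ℝ => (1 + t) ^ a)
    exact ContinuousAt.rpow_const (by fun_prop) (Or.inl (by norm_num))
  have := (isBigO_refl (fun t : ℝ => (1 - t) ^ a) (𝓝[<] 1)).mul this
  simp only [mul_one] at this
  refine this.congr' ?_ EventuallyEq.rfl
  filter_upwards [Ioo_mem_nhdsLT (show (-1 : ℝ) < 1 by norm_num)] with t ht
  rw [W_rpow ht]

lemma QQ.W_isBigO {n : ℤ} {g : ℝ → ℝ} (hg : QQ n g) (a : ℝ) {p : ℝ → ℝ} (hp : Continuous p) :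
    (fun t : ℝ => g t * ((1 - t ^ 2) ^ a * p t)) =O[𝓝[<] 1] fun t => (1 - t) ^ ((n : ℝ) / 2 + a) := by
  have h1 : p =O[𝓝[<] 1] fun _ => (1 : ℝ) :=
    Tendsto.isBigO_one ℝ ((hp.tendsto 1).mono_left nhdsWithin_le_nhds)
  have := hg.isBigO.mul ((_root_.W_isBigO a).mul h1)
  refine this.congr' EventuallyEq.rfl ?_
  filter_upwards [self_mem_nhdsWithin] with t ht
  have : 0 < 1 - t := by simpa using ht
  rw [Real.rpow_add this, mul_one]

lemma rpow_one_sub_tendsto {a : ℝ} (ha : 0 < a) :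
    Tendsto (fun t : ℝ => (1 - t) ^ a) (𝓝[<] 1) (𝓝 0) := by
  have : Continuous (fun t : ℝ => (1 - t) ^ a) :=
    Continuous.rpow_const (by fun_prop) (fun _ => Or.inr ha.le)
  have h := this.tendsto 1
  simp [Real.zero_rpow ha.ne'] at h
  exact h.mono_left nhdsWithin_le_nhds

lemma continuousOn_gWp {g : ℝ → ℝ} (hg : ContinuousOn g (Ioo (-1) 1)) (a : ℝ) {p : ℝ → ℝ}
    (hp : Continuous p) : ContinuousOn (fun t : ℝ => g t * ((1 - t ^ 2) ^ a * p t)) (Ioo (-1) 1) := by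
  refine hg.mul (ContinuousOn.mul ?_ hp.continuousOn)
  apply ContinuousOn.rpow_const (by fun_prop)
  intro t ht
  exact Or.inl (W_pos ht).ne'

lemma Nice.integrable {n : ℤ} {g : ℝ → ℝ} (hg : Nice n g) (a : ℝ) (ha : -1 < (n : ℝ) / 2 + a)
    {p : ℝ → ℝ} (hp : Continuous p) :
    IntervalIntegrable (fun t : ℝ => g t * ((1 - t ^ 2) ^ a * p t)) MeasureTheory.volume (-1) 1 := by
  apply full_integrable _ _ ha
  · exact continuousOn_gWp hg.an.continuousOn a hp
  · exact hg.r.W_isBigO a hp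
  · have := hg.l.W_isBigO a (hp.comp continuous_neg)
    simpa using this

lemma Nice.TT_step {n : ℤ} {g : ℝ → ℝ} (hg : Nice n g) (l : ℝ) (hl : 0 < (n : ℝ) / 2 + l) (k : ℕ) :
    eigN k l * TT k l g = - TT k l (_root_.MM l g) := by
  set p := jp k l with hp
  have hpc : Continuous fun t => p.eval t := p.continuous
  have hpc' : Continuous fun t => p.derivative.eval t := p.derivative.continuous
  have i1 := hg.integrable l (by linarith) hpc
  have i2 := (hg.MM l).integrable l (by push_cast; linarith) hpc
  have hlim : ∀ g : ℝ → ℝ, ∀ q r : ℝ → ℝ, Continuous q → Continuous r → QQ n g →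
      AnalyticOnNhd ℝ g (Ioo (-1) 1) → Tendsto (fun t => g t * ((1 - t ^ 2) ^ (l + 1) * q t) -
        deriv g t * ((1 - t ^ 2) ^ (l + 1) * r t)) (𝓝[<] 1) (𝓝 0) := by
    intro g q r hq hr h1 h2
    have a := (h1.W_isBigO (l + 1) hq).trans_tendsto (rpow_one_sub_tendsto (by linarith))
    have b := ((h1.deriv h2).W_isBigO (l + 1) hr).trans_tendsto
      (rpow_one_sub_tendsto (by push_cast; linarith))
    simpa using a.sub b
  have := intervalIntegral.integral_eq_sub_of_hasDerivAt_of_tendsto (a := (-1 : ℝ)) (b := 1)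
    (f := fun t => g t * ((1 - t ^ 2) ^ (l + 1) * p.derivative.eval t) -
        deriv g t * ((1 - t ^ 2) ^ (l + 1) * p.eval t))
    (f' := fun t => (-eigN k l) * (g t * ((1 - t ^ 2) ^ l * p.eval t)) -
      (_root_.MM l g t) * ((1 - t ^ 2) ^ l * p.eval t))
    (fa := 0) (fb := 0) (by norm_num) ?_ ((i1.const_mul _).sub i2) ?_ ?_
  · rw [intervalIntegral.integral_sub (i1.const_mul _) i2, intervalIntegral.integral_const_mul] at this
    unfold TT
    linear_combination (-cN k l) * this
  · intro t ht
    have h1 := (hg.an t ht).differentiableAt.hasDerivAt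
    have h2 := (hg.an.deriv t ht).differentiableAt.hasDerivAt
    have h3 := hasDerivAt_W ht l
    have h4 := p.hasDerivAt t
    have h5 := p.derivative.hasDerivAt t
    refine ((h1.mul (h3.mul h5)).sub (h2.mul (h3.mul h4))).congr_deriv ?_
    have h6 := jp_ode_eval k l t
    rw [← hp] at h6
    simp only [_root_.MM, Pi.mul_apply, W_succ ht]
    linear_combination g t * (1 - t ^ 2) ^ l * h6
  · have h1 := hlim (fun t => g (-t)) (fun t => p.derivative.eval (-t)) (fun t => - p.eval (-t))
      (by fun_prop) (by fun_prop) hg.l (analytic_neg hg.an)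
    have h2 : Tendsto (fun t : ℝ => -t) (𝓝[>] (-1)) (𝓝[<] 1) := by
      have := tendsto_neg_nhdsGT (a := (-1 : ℝ))
      simpa using this
    have h3 := h1.comp h2
    refine h3.congr ?_
    intro t
    have h4 : ∀ t, deriv (fun t => g (-t)) t = - deriv g (-t) := fun t => deriv_comp_neg _ _
    simp only [Function.comp, h4]
    simp
  · exact hlim g _ _ hpc' hpc hg.r hg.an

lemma Nice.TT_iter (l : ℝ) (k m : ℕ) : ∀ {n : ℤ} {g : ℝ → ℝ} (_ : Nice n g)
    (_ : (m : ℝ) < (n : ℝ) / 2 + l + 1), 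
    (eigN k l) ^ m * TT k l g = (-1) ^ m * TT k l ((_root_.MM l)^[m] g) := by
  induction m with
  | zero => intro n g _ _; simp
  | succ m ih =>
    intro n g hg hm
    push_cast at hm
    have h0 : (0 : ℝ) ≤ m := by positivity
    have h1 := hg.TT_step l (by linarith) k
    have h2 := ih (hg.MM l) (by push_cast; linarith)
    rw [Function.iterate_succ_apply, pow_succ, mul_assoc, h1, pow_succ]
    linear_combination -h2

lemma Nice.iter (l : ℝ) (m : ℕ) : ∀ {n : ℤ} {g : ℝ → ℝ} (_ : Nice n g),
    Nice (n - 2 * m) ((_root_.MM l)^[m] g) := by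
  induction m with
  | zero => intro n g h; simpa using h
  | succ m ih =>
    intro n g h
    have := ih (h.MM l)
    rw [Function.iterate_succ_apply]
    convert this using 1
    push_cast; ring

lemma TT_le (k : ℕ) (l : ℝ) (hl : 0 ≤ l) (h : ℝ → ℝ)
    (hi : IntervalIntegrable (fun t : ℝ => h t * ((1 - t ^ 2) ^ l * 1)) MeasureTheory.volume (-1) 1) :
    |TT k l h| ≤ ∫ t in (-1 : ℝ)..1, |h t * ((1 - t ^ 2) ^ l * 1)| := by
  unfold TT
  rw [← intervalIntegral.integral_const_mul, ← Real.norm_eq_abs]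
  apply intervalIntegral.norm_integral_le_of_norm_le (by norm_num) _ hi.abs
  refine Eventually.of_forall fun t ht => ?_
  have := jp_bound k l hl t ⟨ht.1.le, ht.2⟩
  rw [Real.norm_eq_abs, show cN k l * (h t * ((1 - t ^ 2) ^ l * (jp k l).eval t)) =
    (h t * ((1 - t ^ 2) ^ l * 1)) * (cN k l * (jp k l).eval t) by ring, abs_mul]
  exact mul_le_of_le_one_right (abs_nonneg _) this

lemma Nice.TT_tendsto {g : ℝ → ℝ} (hg : Nice 6 g) (l : ℝ) (hl : 0 ≤ l) :
    Tendsto (fun k : ℕ => TT k l g * (k : ℝ) ^ (2 * l + 5)) atTop (𝓝 0) := by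
  set m := ⌊l + 5 / 2⌋₊ + 1 with hm
  have m1 : l + 5 / 2 < m := by rw [hm]; push_cast; exact Nat.lt_floor_add_one _
  have m2 : (m : ℝ) < l + 4 := by
    have := Nat.floor_le (a := l + 5 / 2) (by positivity)
    rw [hm]; push_cast; linarith
  have hN := Nice.iter l m hg
  have hi := hN.integrable l (by push_cast; linarith) (continuous_const (y := (1 : ℝ)))
  set C := ∫ t in (-1 : ℝ)..1, |((_root_.MM l)^[m] g) t * ((1 - t ^ 2) ^ l * 1)| with hC
  have hb : ∀ k : ℕ, 0 < k → |TT k l g * (k : ℝ) ^ (2 * l + 5)| ≤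
      C * (k : ℝ) ^ (-(2 * m - (2 * l + 5))) := by
    intro k hk
    have hk0 : (0 : ℝ) < k := by exact_mod_cast hk
    have h1 := Nice.TT_iter l k m hg (by push_cast; linarith)
    have h2 := TT_le k l hl _ hi
    rw [← hC] at h2
    have h3 : (k : ℝ) ^ 2 ≤ eigN k l := by unfold eigN; nlinarith
    have h4 : ((k : ℝ) ^ 2) ^ m * |TT k l g| ≤ C := by
      calc ((k : ℝ) ^ 2) ^ m * |TT k l g| ≤ (eigN k l) ^ m * |TT k l g| := by gcongr
        _ = |(eigN k l) ^ m * TT k l g| := by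
            rw [abs_mul, abs_of_nonneg (a := (eigN k l) ^ m)]
            exact pow_nonneg (by nlinarith [sq_nonneg (k : ℝ)]) _
        _ = |TT k l ((_root_.MM l)^[m] g)| := by rw [h1, abs_mul]; simp
        _ ≤ C := h2
    rw [abs_mul, abs_of_nonneg (Real.rpow_nonneg hk0.le _)]
    have h5 : (k : ℝ) ^ (2 * l + 5) = ((k : ℝ) ^ 2) ^ m * (k : ℝ) ^ (-(2 * m - (2 * l + 5))) := by
      rw [← pow_mul, ← Real.rpow_natCast, ← Real.rpow_add hk0]
      congr 1; push_cast; ring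
    rw [h5, ← mul_assoc, mul_comm |TT k l g|]
    gcongr
  have hlim : Tendsto (fun k : ℕ => C * (k : ℝ) ^ (-(2 * m - (2 * l + 5)))) atTop (𝓝 0) := by
    have := ((tendsto_rpow_neg_atTop (y := 2 * m - (2 * l + 5)) (by linarith)).comp
      tendsto_natCast_atTop_atTop).const_mul C
    simpa using this
  refine squeeze_zero_norm' ?_ hlim
  filter_upwards [eventually_gt_atTop 0] with k hk
  exact hb k hk


/-- endpoint model -/
noncomputable def EE (a0 a2 a3 a4 a5 : ℝ) (t : ℝ) : ℝ :=
  (1 + t) ^ 3 * (a0 + a2 * √(1 - t) ^ 2 + a3 * √(1 - t) ^ 3 + a4 * √(1 - t) ^ 4 + a5 * √(1 - t) ^ 5)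

/-- coefficients of the endpoint model -/
noncomputable def gam (a0 a2 a3 a4 a5 : ℝ) : Fin 12 → ℝ :=
  ![8 * a0, 0, 8 * a2 - 12 * a0, 8 * a3, 8 * a4 - 12 * a2 + 6 * a0, 8 * a5 - 12 * a3,
    -12 * a4 + 6 * a2 - a0, -12 * a5 + 6 * a3, 6 * a4 - a2, 6 * a5 - a3, -a4, -a5]

lemma EE_eq_sum (a0 a2 a3 a4 a5 : ℝ) {t : ℝ} (ht : t ∈ Ioo (-1 : ℝ) 1) :
    EE a0 a2 a3 a4 a5 t = ∑ i : Fin 12, gam a0 a2 a3 a4 a5 i * (1 - t) ^ ((i : ℝ) / 2) := by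
  have h0 : 0 ≤ 1 - t := by linarith [ht.2]
  have h1 : ∀ i : ℕ, (1 - t) ^ ((i : ℝ) / 2) = √(1 - t) ^ i := by
    intro i
    rw [Real.sqrt_eq_rpow, ← Real.rpow_natCast, ← Real.rpow_mul h0]
    congr 1; ring
  have h2 : 1 + t = 2 - √(1 - t) ^ 2 := by rw [Real.sq_sqrt h0]; ring
  simp only [h1]
  unfold EE
  rw [h2]
  simp [Fin.sum_univ_succ, gam]
  ring

lemma integrable_model' (k : ℕ) (l : ℝ) (hl : 0 ≤ l) (i : ℕ) :
    IntervalIntegrable (fun t : ℝ => (1 - t) ^ ((i : ℝ) / 2) * ((1 - t ^ 2) ^ l * (jp k l).eval t))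
      MeasureTheory.volume (-1) 1 := 
  integrable_model _ l (by linarith) (by have : (0 : ℝ) ≤ i := by positivity
                                         linarith) _

lemma EE_integrand (a0 a2 a3 a4 a5 l : ℝ) (k : ℕ) {t : ℝ} (ht : t ∈ Ioo (-1 : ℝ) 1) :
    EE a0 a2 a3 a4 a5 t * ((1 - t ^ 2) ^ l * (jp k l).eval t) = 
    ∑ i : Fin 12, gam a0 a2 a3 a4 a5 i *
      ((1 - t) ^ (((i : ℕ) : ℝ) / 2) * ((1 - t ^ 2) ^ l * (jp k l).eval t)) := by
  rw [EE_eq_sum _ _ _ _ _ ht, Finset.sum_mul]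
  simp only [mul_assoc]

lemma EE_integrable (a0 a2 a3 a4 a5 l : ℝ) (hl : 0 ≤ l) (k : ℕ) :
    IntervalIntegrable (fun t => EE a0 a2 a3 a4 a5 t * ((1 - t ^ 2) ^ l * (jp k l).eval t))
      MeasureTheory.volume (-1) 1 := by
  apply intervalIntegrable_congr_Ioo (fun t ht => EE_integrand a0 a2 a3 a4 a5 l k ht)
  have := IntervalIntegrable.sum (Finset.univ : Finset (Fin 12)) (f := fun i t =>
    gam a0 a2 a3 a4 a5 i * ((1 - t) ^ (((i : ℕ) : ℝ) / 2) * ((1 - t ^ 2) ^ l * (jp k l).eval t)))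
    (μ := MeasureTheory.volume) (a := -1) (b := 1)
    (fun i _ => (integrable_model' k l hl i).const_mul _)
  have e : (fun t : ℝ => ∑ i : Fin 12, gam a0 a2 a3 a4 a5 i *
      ((1 - t) ^ (((i : ℕ) : ℝ) / 2) * ((1 - t ^ 2) ^ l * (jp k l).eval t))) =
      ∑ i : Fin 12, fun t : ℝ => gam a0 a2 a3 a4 a5 i *
      ((1 - t) ^ (((i : ℕ) : ℝ) / 2) * ((1 - t ^ 2) ^ l * (jp k l).eval t)) := by
    funext t; simp only [Finset.sum_apply]
  rw [e]
  exact this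

lemma TT_EE (a0 a2 a3 a4 a5 l : ℝ) (hl : 0 ≤ l) (k : ℕ) :
    TT k l (EE a0 a2 a3 a4 a5) = ∑ i : Fin 12, gam a0 a2 a3 a4 a5 i *
      TT k l (fun t => (1 - t) ^ (((i : ℕ) : ℝ) / 2)) := by
  unfold TT
  rw [integral_congr_Ioo' (fun t ht => EE_integrand a0 a2 a3 a4 a5 l k ht)]
  rw [intervalIntegral.integral_finsetSum (s := Finset.univ) (fun (i : Fin 12) _ =>
      (integrable_model' k l hl (i : ℕ)).const_mul (gam a0 a2 a3 a4 a5 i)),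
    Finset.mul_sum]
  apply Finset.sum_congr rfl
  intro i _
  rw [intervalIntegral.integral_const_mul]
  ring

lemma TT_EE_tendsto (a0 a2 a3 a4 a5 l : ℝ) (hl : 0 ≤ l) :
    Tendsto (fun k : ℕ => TT k l (EE a0 a2 a3 a4 a5) * (k : ℝ) ^ (2 * l + 5)) atTop
      (𝓝 (8 * a3 * DD (3 / 2) l)) := by
  have h : Tendsto (fun k : ℕ => ∑ i : Fin 12, gam a0 a2 a3 a4 a5 i *
      (TT k l (fun t => (1 - t) ^ (((i : ℕ) : ℝ) / 2)) * (k : ℝ) ^ (2 * l + 5))) atTop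
      (𝓝 (∑ i : Fin 12, if i = 3 then 8 * a3 * DD (3 / 2) l else 0)) := by
    apply tendsto_finsetSum
    intro i _
    by_cases h1 : i = 1
    · subst h1
      simp [gam]
    by_cases h3 : i = 3
    · subst h3
      simp only [if_true]
      have := TT_model_tendsto (3 / 2) l hl (by norm_num) (by
        intro m hm
        have h1 : (3 : ℝ) = ((2 * m : ℕ) : ℝ) := by push_cast; linarith
        have h2 : 3 = 2 * m := by exact_mod_cast h1
        omega)
      rw [show (2 : ℝ) * (3 / 2) + 2 * l + 2 = 2 * l + 5 by ring] at this
      have h4 := this.const_mul (8 * a3)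
      simpa [gam] using h4
    · rw [if_neg h3]
      have : Tendsto (fun k : ℕ => TT k l (fun t => (1 - t) ^ (((i : ℕ) : ℝ) / 2)) *
          (k : ℝ) ^ (2 * l + 5)) atTop (𝓝 0) := by
        apply TT_model_zero _ l _ hl (by positivity)
        rcases Nat.even_or_odd' (i : ℕ) with ⟨m, hm | hm⟩
        · right
          refine ⟨m, ?_⟩
          rw [hm]; push_cast; ring
        · left
          have h5 : 5 ≤ (i : ℕ) := by
            have h1' : (i : ℕ) ≠ 1 := fun h => h1 (Fin.ext h)
            have h3' : (i : ℕ) ≠ 3 := fun h => h3 (Fin.ext h)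
            omega
          have h6 : (5 : ℝ) ≤ ((i : ℕ) : ℝ) := by exact_mod_cast h5
          linarith
      simpa using this.const_mul (gam a0 a2 a3 a4 a5 i)
  simp only [Finset.sum_ite_eq', Finset.mem_univ, if_true] at h
  refine h.congr ?_
  intro k
  rw [TT_EE _ _ _ _ _ _ hl, Finset.sum_mul]
  apply Finset.sum_congr rfl
  intros; ring

lemma analyticAt_sqrt {x : ℝ} (hx : 0 < x) : AnalyticAt ℝ Real.sqrt x :=
  (Real.contDiffAt_sqrt hx.ne').analyticAt

lemma EE_analytic (a0 a2 a3 a4 a5 : ℝ) : AnalyticOnNhd ℝ (EE a0 a2 a3 a4 a5) (Ioo (-1) 1) := by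
  intro t ht
  have h : AnalyticAt ℝ (fun t : ℝ => √(1 - t)) t :=
    (analyticAt_sqrt (by linarith [ht.2])).fun_comp (f := fun t : ℝ => 1 - t) (by fun_prop)
  unfold EE
  fun_prop

lemma EE_neg_QQ (a0 a2 a3 a4 a5 : ℝ) : QQ 6 (fun t => EE a0 a2 a3 a4 a5 (-t)) := by
  have h : AnalyticAt ℝ (fun y : ℝ => √(2 - y ^ 2)) 0 :=
    (analyticAt_sqrt (by norm_num)).fun_comp (f := fun y : ℝ => 2 - y ^ 2) (by fun_prop)
  refine ⟨fun y => (a0 + a2 * √(2 - y ^ 2) ^ 2 + a3 * √(2 - y ^ 2) ^ 3 + a4 * √(2 - y ^ 2) ^ 4 +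
    a5 * √(2 - y ^ 2) ^ 5), by fun_prop, Eventually.of_forall fun y => ?_⟩
  simp only [EE, zpow_ofNat]
  rw [show 1 - -(1 - y ^ 2) = 2 - y ^ 2 by ring]
  ring

lemma end_expansion (f A : ℝ → ℝ) (a0 a2 a3 : ℝ) (hA : AnalyticAt ℝ A 0)
    (h : ∀ᶠ y in 𝓝[>] (0 : ℝ), f (1 - y ^ 2) = a0 + a2 * y ^ 2 + a3 * y ^ 3 + y ^ 4 * A y) :
    ∃ b0 b2 b4 b5 : ℝ, QQ 6 (fun t => f t - EE b0 b2 (a3 / 8) b4 b5 t) := by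
  obtain ⟨F, hF, hAF⟩ := hA.exists_eventuallyEq_sum_add_pow_mul 2
  simp only [Finset.sum_range_succ, Finset.sum_range_zero, smul_eq_mul] at hAF
  simp at hAF
  set A0 := A 0
  set A1 := deriv A 0
  set b0 := a0 / 8 with hb0
  set b2 := (a2 + 12 * b0) / 8 with hb2
  set b4 := (A0 + 12 * b2 - 6 * b0) / 8 with hb4
  set b5 := (A1 + 12 * (a3 / 8)) / 8 with hb5
  refine ⟨b0, b2, b4, b5, fun y => F y - ((-12 * b4 + 6 * b2 - b0) + (-12 * b5 + 6 * (a3 / 8)) * y +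
    (6 * b4 - b2) * y ^ 2 + (6 * b5 - a3 / 8) * y ^ 3 + (-b4) * y ^ 4 + (-b5) * y ^ 5),
    by fun_prop, ?_⟩
  filter_upwards [h, hAF.filter_mono nhdsWithin_le_nhds, self_mem_nhdsWithin] with y h1 h2 h3
  have h3' : 0 ≤ y := le_of_lt h3
  simp only [EE, h1, h2, zpow_ofNat]
  rw [show 1 - (1 - y ^ 2) = y ^ 2 by ring, Real.sqrt_sq h3']
  simp only [hb4, hb5, hb2, hb0]
  ring

theorem abstract_asymp (f A B : ℝ → ℝ) (a0 a2 a3 b0 b2 b3 l : ℝ) (hl : 0 ≤ l)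
    (hf : AnalyticOnNhd ℝ f (Ioo (-1) 1)) (hA : AnalyticAt ℝ A 0) (hB : AnalyticAt ℝ B 0)
    (h1 : ∀ᶠ y in 𝓝[>] (0 : ℝ), f (1 - y ^ 2) = a0 + a2 * y ^ 2 + a3 * y ^ 3 + y ^ 4 * A y)
    (h2 : ∀ᶠ y in 𝓝[>] (0 : ℝ), f (-(1 - y ^ 2)) = b0 + b2 * y ^ 2 + b3 * y ^ 3 + y ^ 4 * B y) :
    Tendsto (fun k : ℕ => TT k l f * (k : ℝ) ^ (2 * l + 5) -
      DD (3 / 2) l * (a3 + (-1) ^ k * b3)) atTop (𝓝 0) := by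
  obtain ⟨p0, p2, p4, p5, hp⟩ := end_expansion f A a0 a2 a3 hA h1
  obtain ⟨q0, q2, q4, q5, hq⟩ := end_expansion (fun t => f (-t)) B b0 b2 b3 hB h2
  set E1 := EE p0 p2 (a3 / 8) p4 p5 with hE1
  set E2 := EE q0 q2 (b3 / 8) q4 q5 with hE2
  set g : ℝ → ℝ := fun t => f t - E1 t - E2 (-t) with hg
  have hE1a : AnalyticOnNhd ℝ E1 (Ioo (-1) 1) := EE_analytic _ _ _ _ _
  have hE2a : AnalyticOnNhd ℝ E2 (Ioo (-1) 1) := EE_analytic _ _ _ _ _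
  have hnice : Nice 6 g := by
    refine ⟨?_, ?_, ?_⟩
    · intro t ht
      exact ((hf t ht).fun_sub (hE1a t ht)).fun_sub (analytic_neg hE2a t ht)
    · have := hp.add ((EE_neg_QQ q0 q2 (b3 / 8) q4 q5).const_mul (-1))
      convert this using 2 with t
      simp only [hg, hE1, hE2]; ring
    · have := hq.add ((EE_neg_QQ p0 p2 (a3 / 8) p4 p5).const_mul (-1))
      convert this using 2 with t
      simp only [hg, hE1, hE2, neg_neg]; ring
  have hT : ∀ k, TT k l f = TT k l g + TT k l E1 + (-1) ^ k * TT k l E2 := by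
    intro k
    have i0 := hnice.integrable l (by push_cast; linarith) (jp k l).continuous
    have i1 : IntervalIntegrable (fun t => E1 t * ((1 - t ^ 2) ^ l * (jp k l).eval t))
      MeasureTheory.volume (-1) 1 := EE_integrable p0 p2 (a3 / 8) p4 p5 l hl k
    have i2 : IntervalIntegrable (fun t => E2 (-t) * ((1 - t ^ 2) ^ l * (jp k l).eval t))
        MeasureTheory.volume (-1) 1 := by
      have := (IntervalIntegrable.iff_comp_neg).1 (EE_integrable q0 q2 (b3 / 8) q4 q5 l hl k)
      have h3 := (this.const_mul ((-1) ^ k)).symm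
      simp only [neg_neg, neg_sq, jp_eval_neg] at h3
      convert h3 using 2 with t
      have : ((-1 : ℝ) ^ k) * (-1) ^ k = 1 := by rw [← mul_pow]; simp
      linear_combination (-(E2 (-t) * ((1 - t ^ 2) ^ l * (jp k l).eval t))) * this
    rw [← TT_neg]
    unfold TT
    rw [← mul_add, ← mul_add, ← intervalIntegral.integral_add i0 i1,
      ← intervalIntegral.integral_add (i0.add i1) i2]
    congr 1
    apply intervalIntegral.integral_congr
    intro t _
    simp only [hg]; ring
  have t0 := hnice.TT_tendsto l hl
  have t1 := TT_EE_tendsto p0 p2 (a3 / 8) p4 p5 l hl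
  have t2 := TT_EE_tendsto q0 q2 (b3 / 8) q4 q5 l hl
  have t1' := t1.sub_const (8 * (a3 / 8) * DD (3 / 2) l)
  have t2' := t2.sub_const (8 * (b3 / 8) * DD (3 / 2) l)
  rw [sub_self] at t1' t2'
  have t3 : Tendsto (fun k : ℕ => (-1 : ℝ) ^ k * (TT k l E2 * (k : ℝ) ^ (2 * l + 5) -
      8 * (b3 / 8) * DD (3 / 2) l)) atTop (𝓝 0) := by
    rw [tendsto_zero_iff_norm_tendsto_zero] at t2' ⊢
    simpa using t2'
  have t4 := (t0.add t1').add t3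
  simp only [add_zero] at t4
  refine t4.congr ?_
  intro k
  rw [hT k]
  ring


lemma ord_up {f : ℝ → ℝ} (hf : AnalyticAt ℝ f 0) (h0 : f 0 = 0) {n : ℕ} {W : ℝ → ℝ}
    (hW : AnalyticAt ℝ W 0) (h : ∀ᶠ y in 𝓝 (0 : ℝ), deriv f y = y ^ n * W y) :
    ∃ F : ℝ → ℝ, AnalyticAt ℝ F 0 ∧ ∀ᶠ y in 𝓝 (0 : ℝ), f y = y ^ (n + 1) * F y := by
  have h1 : (n : ℕ∞) ≤ analyticOrderAt (deriv f) 0 := by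
    rw [natCast_le_analyticOrderAt hf.deriv]
    exact ⟨W, hW, by simpa using h⟩
  have h2 : ((n + 1 : ℕ) : ℕ∞) ≤ analyticOrderAt f 0 := by
    have := hf.analyticOrderAt_deriv_add_one
    simp only [h0, sub_zero] at this
    rw [← this]
    push_cast
    gcongr
  rw [natCast_le_analyticOrderAt hf] at h2
  obtain ⟨F, hF, h3⟩ := h2
  exact ⟨F, hF, by simpa using h3⟩

lemma ord_one {f : ℝ → ℝ} (hf : AnalyticAt ℝ f 0) (h0 : f 0 = 0) :
    ∃ F : ℝ → ℝ, AnalyticAt ℝ F 0 ∧ ∀ᶠ y in 𝓝 (0 : ℝ), f y = y * F y := by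
  have := ord_up hf h0 (n := 0) hf.deriv (by simp)
  simpa using this

/-- the local form of kappa1 at the right endpoint -/
noncomputable def KK (y : ℝ) : ℝ :=
  (y * √(2 - y ^ 2) + (1 - y ^ 2) * (π - 2 * arcsin (y / √2))) / π

/-- cubic coefficient -/
noncomputable def cc : ℝ := 4 / (3 * π * √2)

lemma cc_pos : 0 < cc := by
  unfold cc; have := Real.pi_pos; positivity

lemma analyticAt_arcsin' {x : ℝ} (hx : x ∈ Ioo (-1 : ℝ) 1) : AnalyticAt ℝ arcsin x :=
  (contDiffAt_arcsin hx.1.ne' hx.2.ne).analyticAt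

lemma analyticAt_arccos' {x : ℝ} (hx : x ∈ Ioo (-1 : ℝ) 1) : AnalyticAt ℝ arccos x :=
  (contDiffAt_arccos hx.1.ne' hx.2.ne).analyticAt

lemma VV_analytic : AnalyticAt ℝ (fun y : ℝ => arcsin (y / √2)) 0 :=
  (analyticAt_arcsin' (by simp)).fun_comp (f := fun y : ℝ => y / √2)
    (analyticAt_id.fun_div analyticAt_const (by positivity))

lemma SS_analytic : AnalyticAt ℝ (fun y : ℝ => √(2 - y ^ 2)) 0 :=
  (analyticAt_sqrt (by norm_num)).fun_comp (f := fun y : ℝ => 2 - y ^ 2) (by fun_prop)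

lemma KK_analytic : AnalyticAt ℝ KK 0 := by
  unfold KK
  have h1 := VV_analytic
  have h2 := SS_analytic
  refine AnalyticAt.fun_div ?_ analyticAt_const Real.pi_ne_zero
  fun_prop

lemma VV_deriv {y : ℝ} (hy : y ∈ Ioo (-1 : ℝ) 1) :
    HasDerivAt (fun y : ℝ => arcsin (y / √2)) (1 / √(2 - y ^ 2)) y := by
  have h2 : (0 : ℝ) < √2 := by positivity
  have h22 : √2 ^ 2 = (2 : ℝ) := Real.sq_sqrt (by norm_num)
  have h12 : 1 < √2 := by nlinarith
  have a1 : y / √2 < 1 := by rw [div_lt_one h2]; linarith [hy.2]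
  have a2 : -1 < y / √2 := by rw [lt_div_iff₀ h2]; linarith [hy.1]
  have := (hasDerivAt_arcsin a2.ne' a1.ne).comp y ((hasDerivAt_id y).div_const √2)
  refine HasDerivAt.congr_deriv this ?_
  have e : √(2 - y ^ 2) = √2 * √(1 - (y / √2) ^ 2) := by
    rw [← Real.sqrt_mul (by norm_num)]
    congr 1
    rw [div_pow, h22]; ring
  rw [e]
  field_simp

lemma SS_deriv {y : ℝ} (hy : y ∈ Ioo (-1 : ℝ) 1) :
    HasDerivAt (fun y : ℝ => √(2 - y ^ 2)) (-y / √(2 - y ^ 2)) y := by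
  have h : 0 < 2 - y ^ 2 := by nlinarith [hy.1, hy.2]
  have := HasDerivAt.sqrt (((hasDerivAt_pow 2 y)).const_sub 2) h.ne'
  refine HasDerivAt.congr_deriv this ?_
  have : 0 < √(2 - y ^ 2) := by positivity
  field_simp
  norm_num

lemma KK_deriv {y : ℝ} (hy : y ∈ Ioo (-1 : ℝ) 1) :
    HasDerivAt KK (-2 * y + 4 / π * y * arcsin (y / √2)) y := by
  have h : 0 < 2 - y ^ 2 := by nlinarith [hy.1, hy.2]
  have hs : 0 < √(2 - y ^ 2) := by positivity
  have hq : √(2 - y ^ 2) ^ 2 = 2 - y ^ 2 := Real.sq_sqrt h.le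
  have h1 := (hasDerivAt_id y).mul (SS_deriv hy)
  have h2 := ((hasDerivAt_pow 2 y).const_sub 1).mul (((VV_deriv hy).const_mul 2).const_sub π)
  have := (h1.add h2).div_const π
  refine HasDerivAt.congr_deriv this ?_
  have := Real.pi_pos
  simp only [id]
  field_simp
  push_cast
  ring_nf
  rw [show √(2 - y ^ 2) ^ 2 = 2 - y ^ 2 from hq]
  ring

lemma Ioo_mem : ∀ᶠ y in 𝓝 (0 : ℝ), y ∈ Ioo (-1 : ℝ) 1 := Ioo_mem_nhds (by norm_num) (by norm_num)

lemma VV_expand : ∃ F : ℝ → ℝ, AnalyticAt ℝ F 0 ∧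
    ∀ᶠ y in 𝓝 (0 : ℝ), arcsin (y / √2) - y / √2 = y ^ 2 * F y := by
  have ha : AnalyticAt ℝ (fun y : ℝ => arcsin (y / √2) - y / √2) 0 :=
    VV_analytic.fun_sub (analyticAt_id.fun_div analyticAt_const (by positivity))
  have hd : ∀ᶠ y in 𝓝 (0 : ℝ), deriv (fun y : ℝ => arcsin (y / √2) - y / √2) y =
      1 / √(2 - y ^ 2) - 1 / √2 := by
    filter_upwards [Ioo_mem] with y hy
    exact ((VV_deriv hy).fun_sub ((hasDerivAt_id y).div_const √2)).deriv
  obtain ⟨W, hW, h⟩ := ord_one ha.deriv (by rw [hd.self_of_nhds]; simp)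
  exact ord_up ha (by simp) (n := 1) hW (by simpa using h)

lemma KK_expand : ∃ B : ℝ → ℝ, AnalyticAt ℝ B 0 ∧
    ∀ᶠ y in 𝓝 (0 : ℝ), KK y = 1 - y ^ 2 + cc * y ^ 3 + y ^ 4 * B y := by
  obtain ⟨F, hF, h⟩ := VV_expand
  have ha : AnalyticAt ℝ (fun y : ℝ => KK y - (1 - y ^ 2 + cc * y ^ 3)) 0 :=
    KK_analytic.fun_sub (by fun_prop)
  have hd : ∀ᶠ y in 𝓝 (0 : ℝ), deriv (fun y : ℝ => KK y - (1 - y ^ 2 + cc * y ^ 3)) y =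
      y ^ 3 * (4 / π * F y) := by
    filter_upwards [Ioo_mem, h] with y hy hF
    have := ((KK_deriv hy).fun_sub
      (((hasDerivAt_pow 2 y).const_sub 1).fun_add ((hasDerivAt_pow 3 y).const_mul cc))).deriv
    rw [this]
    have e : arcsin (y / √2) = y / √2 + y ^ 2 * F y := by linarith
    rw [e]
    have := Real.pi_pos
    unfold cc
    push_cast
    field_simp
    ring
  obtain ⟨B, hB, h2⟩ := ord_up ha (by
    simp only [KK]; simp [Real.pi_ne_zero]) (n := 3) (by fun_prop) hd
  refine ⟨B, hB, ?_⟩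
  filter_upwards [h2] with y hy
  linear_combination hy

lemma arccos_one_sub_sq {y : ℝ} (h0 : 0 ≤ y) (h1 : y ≤ 1) :
    arccos (1 - y ^ 2) = 2 * arcsin (y / √2) := by
  have h2 : (0 : ℝ) < √2 := by positivity
  have h22 : √2 ^ 2 = (2 : ℝ) := Real.sq_sqrt (by norm_num)
  have h12 : 1 < √2 := by nlinarith
  have a0 : 0 ≤ y / √2 := by positivity
  have a1 : y / √2 ≤ 1 := by rw [div_le_one h2]; linarith
  have e : 1 - y ^ 2 = cos (2 * arcsin (y / √2)) := by
    rw [Real.cos_two_mul, Real.cos_sq', Real.sin_arcsin (by linarith) a1, div_pow, h22]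
    ring
  rw [e, Real.arccos_cos]
  · have := Real.arcsin_nonneg.2 a0; linarith
  · have := Real.arcsin_le_pi_div_two (y / √2); linarith

lemma kappa1_KK {y : ℝ} (h0 : 0 ≤ y) (h1 : y ≤ 1) : kappa1 (1 - y ^ 2) = KK y := by
  unfold kappa1 KK
  rw [arccos_one_sub_sq h0 h1]
  congr 2
  rw [show 1 - (1 - y ^ 2) ^ 2 = y ^ 2 * (2 - y ^ 2) by ring, Real.sqrt_mul (sq_nonneg y),
    Real.sqrt_sq h0]

lemma kappa1_neg (x : ℝ) : kappa1 (-x) = kappa1 x - x := by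
  unfold kappa1
  rw [Real.arccos_neg]
  have := Real.pi_pos
  simp only [neg_sq]
  field_simp
  ring

lemma kappa1_hasDerivAt {u : ℝ} (hu : u ∈ Ioo (-1 : ℝ) 1) : HasDerivAt kappa1 (kappa0 u) u := by
  have h : 0 < 1 - u ^ 2 := by nlinarith [hu.1, hu.2]
  have hs : 0 < √(1 - u ^ 2) := by positivity
  have h1 := HasDerivAt.sqrt (((hasDerivAt_pow 2 u)).const_sub 1) h.ne'
  have h2 := (hasDerivAt_id u).mul ((hasDerivAt_arccos hu.1.ne' hu.2.ne).const_sub π)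
  have := (h1.add h2).div_const π
  refine HasDerivAt.congr_deriv this ?_
  unfold kappa0
  have := Real.pi_pos
  simp only [id]
  field_simp
  push_cast
  ring

lemma kappa0_mem {u : ℝ} (hu : u ∈ Ioo (-1 : ℝ) 1) : kappa0 u ∈ Ioo (0 : ℝ) 1 := by
  have h1 : 0 < arccos u := Real.arccos_pos.2 hu.2
  have h2 : arccos u < π := by
    have := Real.arccos_pos.2 (show -u < 1 by linarith [hu.1])
    rw [Real.arccos_neg] at this; linarith
  have := Real.pi_pos
  have h3 : arccos u / π < 1 := by rw [div_lt_one this]; exact h2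
  have h4 : 0 < arccos u / π := by positivity
  unfold kappa0
  constructor <;> linarith

lemma kappa1_mem {u : ℝ} (hu : u ∈ Ioo (-1 : ℝ) 1) : kappa1 u ∈ Ioo (0 : ℝ) 1 := by
  have hc : Continuous kappa1 := by
    unfold kappa1
    have := Real.continuous_arccos
    fun_prop
  have hm : StrictMonoOn kappa1 (Icc (-1) 1) := by
    apply strictMonoOn_of_deriv_pos (convex_Icc _ _) hc.continuousOn
    intro x hx
    rw [interior_Icc] at hx
    rw [(kappa1_hasDerivAt hx).deriv]
    exact (kappa0_mem hx).1
  have e1 : kappa1 1 = 1 := by simp [kappa1, Real.pi_ne_zero]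
  have e0 : kappa1 (-1) = 0 := by rw [kappa1_neg, e1]; ring
  have hu' : u ∈ Icc (-1 : ℝ) 1 := ⟨hu.1.le, hu.2.le⟩
  constructor
  · rw [← e0]; exact hm (by simp) hu' hu.1
  · have := hm hu' (by simp) hu.2
    rwa [e1] at this

lemma kappa1_analytic : AnalyticOnNhd ℝ kappa1 (Ioo (-1) 1) := by
  intro u hu
  have h1 := analyticAt_arccos' hu
  have h2 : AnalyticAt ℝ (fun u : ℝ => √(1 - u ^ 2)) u :=
    (analyticAt_sqrt (by nlinarith [hu.1, hu.2])).fun_comp (f := fun y : ℝ => 1 - y ^ 2) (by fun_prop)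
  unfold kappa1
  refine AnalyticAt.fun_div ?_ analyticAt_const Real.pi_ne_zero
  fun_prop

lemma iter_props (m : ℕ) : ∀ u ∈ Ioo (-1 : ℝ) 1, kappa1^[m] u ∈ Ioo (-1 : ℝ) 1 ∧
    AnalyticAt ℝ (kappa1^[m]) u ∧ 0 ≤ deriv (kappa1^[m]) u ∧ deriv (kappa1^[m]) u ≤ 1 := by
  induction m with
  | zero => 
    intro u hu
    refine ⟨by simpa using hu, by simpa using analyticAt_id, ?_, ?_⟩ <;> simp
  | succ m ih =>
    intro u hu
    obtain ⟨h1, h2, h3, h4⟩ := ih u hu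
    have k1 := kappa1_mem h1
    have k0 := kappa0_mem h1
    have e : kappa1^[m + 1] = kappa1 ∘ kappa1^[m] := Function.iterate_succ' _ _
    have hd : HasDerivAt (kappa1^[m + 1]) (kappa0 (kappa1^[m] u) * deriv (kappa1^[m]) u) u := by
      rw [e]
      exact (kappa1_hasDerivAt h1).comp u h2.differentiableAt.hasDerivAt
    refine ⟨?_, ?_, ?_, ?_⟩
    · rw [e]; exact ⟨by have := k1.1; simp only [Function.comp]; linarith, k1.2⟩
    · rw [e]; exact (kappa1_analytic _ h1).comp h2
    · rw [hd.deriv]; exact mul_nonneg k0.1.le h3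
    · rw [hd.deriv]; nlinarith [k0.1, k0.2]

lemma right_expand (m : ℕ) : ∃ A : ℝ → ℝ, AnalyticAt ℝ A 0 ∧ ∀ᶠ y in 𝓝[>] (0 : ℝ),
    kappa1^[m] (1 - y ^ 2) = 1 + (-1) * y ^ 2 + (m * cc) * y ^ 3 + y ^ 4 * A y := by
  induction m with
  | zero =>
    refine ⟨fun _ => 0, analyticAt_const, Eventually.of_forall fun y => ?_⟩
    simp; ring
  | succ m ih =>
    obtain ⟨A, hA, h⟩ := ih
    obtain ⟨B, hB, hK⟩ := KK_expand
    set q : ℝ → ℝ := fun y => 1 - m * cc * y - y ^ 2 * A y with hq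
    have hqa : AnalyticAt ℝ q 0 := by simp only [hq]; fun_prop
    have hq0 : q 0 = 1 := by simp [hq]
    have hs : AnalyticAt ℝ (fun y => √(q y)) 0 :=
      (analyticAt_sqrt (by rw [hq0]; norm_num)).fun_comp (f := q) hqa
    have hY : AnalyticAt ℝ (fun y => y * √(q y)) 0 := by fun_prop
    obtain ⟨E, hE, hE'⟩ := ord_one (f := fun y => √(q y) ^ 3 - 1) (by fun_prop) (by simp [hq0])
    have hBY : AnalyticAt ℝ (fun y => B (y * √(q y))) 0 :=
      AnalyticAt.fun_comp (f := fun y => y * √(q y)) (g := B) (by simpa using hB) hY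
    refine ⟨fun y => A y + cc * E y + q y ^ 2 * B (y * √(q y)),
      AnalyticAt.fun_add (by fun_prop) (AnalyticAt.fun_mul (by fun_prop) hBY), ?_⟩
    have hYt : Tendsto (fun y => y * √(q y)) (𝓝 0) (𝓝 0) := by
      have := hY.continuousAt.tendsto
      simpa using this
    have e1 := hYt.eventually hK
    have e2 := hYt.eventually (Ioo_mem)
    have e3 : ∀ᶠ y in 𝓝 (0 : ℝ), 0 < q y := by
      apply hqa.continuousAt.eventually (lt_mem_nhds _)
      rw [hq0]; norm_num
    filter_upwards [h, hE'.filter_mono nhdsWithin_le_nhds, e1.filter_mono nhdsWithin_le_nhds,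
      e2.filter_mono nhdsWithin_le_nhds, e3.filter_mono nhdsWithin_le_nhds, self_mem_nhdsWithin]
      with y g1 g2 g3 g4 g5 g6
    have g6' : 0 < y := g6
    have hsq : √(q y) ^ 2 = q y := Real.sq_sqrt g5.le
    have x1 : kappa1^[m] (1 - y ^ 2) = 1 - (y * √(q y)) ^ 2 := by
      rw [g1, mul_pow, hsq]; simp only [hq]; ring
    rw [Function.iterate_succ_apply', x1, kappa1_KK (by positivity) g4.2.le, g3]
    have x2 : √(q y) ^ 3 = 1 + y * E y := by linarith
    have x3 : √(q y) ^ 4 = q y ^ 2 := by rw [show √(q y) ^ 4 = (√(q y) ^ 2) ^ 2 by ring, hsq]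
    rw [mul_pow, mul_pow, mul_pow, hsq, x2, x3]
    push_cast
    simp only [hq]
    ring

lemma left_expand (m : ℕ) : ∃ B : ℝ → ℝ, AnalyticAt ℝ B 0 ∧ ∀ᶠ y in 𝓝[>] (0 : ℝ),
    kappa1^[m + 1] (-(1 - y ^ 2)) = kappa1^[m] 0 + 0 * y ^ 2 + (deriv (kappa1^[m]) 0 * cc) * y ^ 3 +
      y ^ 4 * B y := by
  obtain ⟨B, hB, hK⟩ := KK_expand
  obtain ⟨-, ha, -, -⟩ := iter_props m 0 (by norm_num)
  obtain ⟨F, hF, hAF⟩ := ha.exists_eventuallyEq_sum_add_pow_mul 2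
  simp only [Finset.sum_range_succ, Finset.sum_range_zero, smul_eq_mul] at hAF
  simp at hAF
  set N : ℝ → ℝ := fun y => cc * y ^ 3 + y ^ 4 * B y with hN
  have hNa : AnalyticAt ℝ N 0 := by simp only [hN]; fun_prop
  have hN0 : N 0 = 0 := by simp [hN]
  have hFN : AnalyticAt ℝ (fun y => F (N y)) 0 :=
    AnalyticAt.fun_comp (f := N) (g := F) (by rwa [hN0]) hNa
  refine ⟨fun y => deriv (kappa1^[m]) 0 * B y + y ^ 2 * (cc + y * B y) ^ 2 * F (N y),
    AnalyticAt.fun_add (by fun_prop) (AnalyticAt.fun_mul (by fun_prop) hFN), ?_⟩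
  have hNt : Tendsto N (𝓝 0) (𝓝 0) := by
    have := hNa.continuousAt.tendsto
    rwa [hN0] at this
  have e1 := hNt.eventually hAF
  filter_upwards [hK.filter_mono nhdsWithin_le_nhds, e1.filter_mono nhdsWithin_le_nhds,
    Ioo_mem.filter_mono nhdsWithin_le_nhds, self_mem_nhdsWithin] with y g1 g2 g3 g4
  have g4' : 0 < y := g4
  have x1 : kappa1 (-(1 - y ^ 2)) = N y := by
    rw [kappa1_neg, kappa1_KK g4'.le g3.2.le, g1]; simp only [hN]; ring
  rw [Function.iterate_succ_apply, x1, g2]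
  simp only [hN]
  ring

lemma DD_ne (l : ℝ) (hl : 0 ≤ l) : DD (3 / 2) l ≠ 0 := by
  unfold DD
  have h1 : Real.Gamma (-(3 / 2)) ≠ 0 := by
    apply Real.Gamma_ne_zero
    intro m hm
    have h1 : (3 : ℝ) = ((2 * m : ℕ) : ℝ) := by push_cast; linarith
    have h2 : 3 = 2 * m := by exact_mod_cast h1
    omega
  have h2 : 0 < Real.Gamma (l + 1) := Real.Gamma_pos_of_pos (by positivity)
  have h3 : 0 < Real.Gamma (3 / 2 + l + 1) := Real.Gamma_pos_of_pos (by positivity)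
  have h4 : (0 : ℝ) < 2 ^ (3 / 2 + 2 * l + 1) := by positivity
  exact div_ne_zero (by positivity) h1

lemma sphere_pos (p : ℕ) (hp : 0 < p) : 0 < sphereSurface p := by
  unfold sphereSurface
  have h0 : (0 : ℝ) < p := by exact_mod_cast hp
  have h2 : 0 < Real.Gamma ((p : ℝ) / 2) := Real.Gamma_pos_of_pos (by positivity)
  have := Real.pi_pos
  positivity

lemma ratio_tendsto (F : Filter ℕ) (hF : F ≤ atTop) (u : ℕ → ℝ) (D e C M : ℝ) (hM : M ≠ 0)
    (hC : C ≠ 0)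
    (h : Tendsto (fun k : ℕ => u k * (k : ℝ) ^ e) F (𝓝 M)) (hD : D = -e) :
    Tendsto (fun k : ℕ => C * u k / (C * M * (k : ℝ) ^ D)) F (𝓝 1) := by
  have h1 := h.div_const M
  rw [div_self hM] at h1
  refine h1.congr' ?_
  filter_upwards [(eventually_gt_atTop 0).filter_mono hF] with k hk
  have hk' : (0 : ℝ) < k := by exact_mod_cast hk
  rw [hD, Real.rpow_neg hk'.le]
  have : 0 < (k : ℝ) ^ e := by positivity
  field_simp

theorem deep_rf_decay (d L : ℕ) (hd : 3 ≤ d) (hL : 3 ≤ L) :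
    ∃ Ce Co : ℝ, Ce ≠ 0 ∧ Co ≠ 0 ∧
      Tendsto (fun k : ℕ =>
          legendreCoeff d k (kappa1^[L - 1]) / (Ce * (k : ℝ) ^ (-(d : ℝ) - 2)))
        (atTop ⊓ 𝓟 {k | Even k}) (𝓝 1) ∧
      Tendsto (fun k : ℕ =>
          legendreCoeff d k (kappa1^[L - 1]) / (Co * (k : ℝ) ^ (-(d : ℝ) - 2)))
        (atTop ⊓ 𝓟 {k | Odd k}) (𝓝 1) := by
  obtain ⟨n, rfl⟩ : ∃ n, L = n + 3 := ⟨L - 3, by omega⟩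
  rw [show n + 3 - 1 = (n + 1) + 1 by omega]
  obtain ⟨A, hA, h1⟩ := right_expand (n + 1 + 1)
  obtain ⟨B, hB, h2⟩ := left_expand (n + 1)
  obtain ⟨-, -, p0, p1⟩ := iter_props (n + 1) 0 (by norm_num)
  set D := deriv (kappa1^[n + 1]) 0 with hD
  have hd' : (3 : ℝ) ≤ d := by exact_mod_cast hd
  set l : ℝ := ((d : ℝ) - 3) / 2 with hl
  have hl0 : 0 ≤ l := by rw [hl]; linarith
  have key := abstract_asymp (kappa1^[n + 1 + 1]) A B _ _ _ _ _ _ l hl0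
    (fun u hu => (iter_props _ u hu).2.1) hA hB h1 h2
  have hDD := DD_ne l hl0
  have hcc := cc_pos
  set C := sphereSurface (d - 1) / sphereSurface d with hC
  have hC0 : C ≠ 0 := (div_pos (sphere_pos _ (by omega)) (sphere_pos _ (by omega))).ne'
  have hn : (0 : ℝ) ≤ n := by positivity
  set a3 : ℝ := ((n + 1 + 1 : ℕ) : ℝ) * cc with ha3
  have ha3' : 2 * cc ≤ a3 := by rw [ha3]; push_cast; nlinarith
  have hb1 : 0 ≤ D * cc := by positivity
  have hb2 : D * cc ≤ cc := by nlinarith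
  have me : DD (3 / 2) l * (a3 + D * cc) ≠ 0 := mul_ne_zero hDD (by linarith)
  have mo : DD (3 / 2) l * (a3 - D * cc) ≠ 0 := mul_ne_zero hDD (by linarith)
  have hexp : -(d : ℝ) - 2 = -(2 * l + 5) := by rw [hl]; ring
  have te : Tendsto (fun k : ℕ => TT k l (kappa1^[n + 1 + 1]) * (k : ℝ) ^ (2 * l + 5))
      (atTop ⊓ 𝓟 {k | Even k}) (𝓝 (DD (3 / 2) l * (a3 + D * cc))) := by
    have := (key.mono_left (inf_le_left : atTop ⊓ 𝓟 {k | Even k} ≤ atTop)).add_const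
      (DD (3 / 2) l * (a3 + D * cc))
    rw [zero_add] at this
    refine this.congr' ?_
    filter_upwards [mem_inf_of_right (mem_principal_self {k : ℕ | Even k})] with k hk
    rw [Even.neg_one_pow hk]
    ring
  have tod : Tendsto (fun k : ℕ => TT k l (kappa1^[n + 1 + 1]) * (k : ℝ) ^ (2 * l + 5))
      (atTop ⊓ 𝓟 {k | Odd k}) (𝓝 (DD (3 / 2) l * (a3 - D * cc))) := by
    have := (key.mono_left (inf_le_left : atTop ⊓ 𝓟 {k | Odd k} ≤ atTop)).add_const
      (DD (3 / 2) l * (a3 - D * cc))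
    rw [zero_add] at this
    refine this.congr' ?_
    filter_upwards [mem_inf_of_right (mem_principal_self {k : ℕ | Odd k})] with k hk
    rw [Odd.neg_one_pow hk]
    ring
  refine ⟨C * (DD (3 / 2) l * (a3 + D * cc)), C * (DD (3 / 2) l * (a3 - D * cc)),
    mul_ne_zero hC0 me, mul_ne_zero hC0 mo, ?_, ?_⟩
  · simp only [legendreCoeff_eq]
    exact ratio_tendsto _ inf_le_left _ _ _ _ _ me hC0 te hexp
  · simp only [legendreCoeff_eq]
    exact ratio_tendsto _ inf_le_left _ _ _ _ _ mo hC0 tod hexp
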